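/- arXiv:2107.02697 — 4 statements merged into one kernel-verified Lean document; each statement's English description precedes it below -/
import Mathlib

section
/- Let D_N be the graph Laplacian of the star graph Γ_N on vertices {p_0, p_1, …, p_N} with a single edge from p_0 to each p_j (so the Laplacian is Δf(x) = (1/deg x) Σ_{y∼x}(f(y)−f(x))). For z ≠ −1, the Schur complement of the block of D_N − zI corresponding to the vertex p_0 equals ((N−1)/(N(1+z)))·D̃_N − (1 + z − 1/(1+z))·I, where D̃_N is the graph Laplacian of the complete graph on {p_1,…,p_N}. -/
noncomputable section

/-- The graph Laplacian of the star graph `Γ_N`: vertex `0` is the center `p_0`,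
joined by a single edge to each of the `N` leaves. -/
def Dstar (N : ℕ) : Matrix (Fin (N + 1)) (Fin (N + 1)) ℝ :=
  Matrix.of fun i j =>
    if i = 0 then (if j = 0 then -1 else 1 / (N : ℝ))
    else if j = 0 then 1
    else if i = j then -1 else 0

/-- The graph Laplacian of the complete graph `K_N` on the leaves `p_1, …, p_N`. -/
def Dtilde (N : ℕ) : Matrix (Fin N) (Fin N) ℝ :=
  Matrix.of fun i j => if i = j then -1 else 1 / ((N : ℝ) - 1)

/-- For `z ≠ -1`, the Schur complement of the `p_0` block of `D_N - z` equals
`((N-1)/(N(1+z))) • D̃_N - (1 + z - 1/(1+z)) • I`. -/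
theorem star_schur (N : ℕ) (hN : 1 ≤ N) (z : ℝ) (hz : z ≠ -1) :
    (Matrix.of fun i j : Fin N => Dstar N i.succ j.succ)
        - z • (1 : Matrix (Fin N) (Fin N) ℝ)
        - (Matrix.of fun i j : Fin N =>
            Dstar N i.succ 0 * (Dstar N 0 0 - z)⁻¹ * Dstar N 0 j.succ)
      = (((N : ℝ) - 1) / ((N : ℝ) * (1 + z))) • Dtilde N
          - (1 + z - 1 / (1 + z)) • (1 : Matrix (Fin N) (Fin N) ℝ) := by
  have hN0 : (N : ℝ) ≠ 0 := Nat.cast_ne_zero.mpr (by omega)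
  have hz1 : 1 + z ≠ 0 := fun h => hz (by linarith)
  have hinv : (-1 - z)⁻¹ = -(1 + z)⁻¹ := by rw [← inv_neg]; congr 1; ring
  ext i j
  by_cases hij : i = j
  · subst hij
    simp [Dstar, Dtilde, hinv]
    field_simp
    ring
  · have hN1 : (N : ℝ) - 1 ≠ 0 := by
      have : N ≠ 1 := by
        rintro rfl
        exact hij (Subsingleton.elim i j)
      exact sub_ne_zero.mpr (by exact_mod_cast this)
    simp [Dstar, Dtilde, hinv, hij]
    field_simp
end
end

section
/- The spectrum of the Laplacian Δ^H_n of the Hanoi towers Schreier graph H_n equals {0} ∪ (∪_{i=0}^{n−1} R_H^{−i}(−1)) ∪ (∪_{j=0}^{n−2} R_H^{−j}(−5/3)), where R_H(z) = z(3z+5): the eigenvalue 0 has multiplicity 1, each element of R_H^{−i}(−1) has multiplicity (3^{n−1−i}+3)/2, and each element of R_H^{−j}(−5/3) has multiplicity (3^{n−1−j}−1)/2; R_H^{−i}(−1) contains 2^i elements and R_H^{−j}(−5/3) contains 2^j elements. -/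
noncomputable section
attribute [local instance] Classical.propDecidable

/-- Adjacency in the level-`n` Hanoi towers Schreier graph, whose vertices are
the words `w ∈ {1,2,3}^n`: `w ∼ w'` iff `w = u·i·jj⋯j` and `w' = u·j·ii⋯i`
for some letters `i ≠ j` (they agree before position `k`, differ there, and
afterwards `w` is constantly `w' k` and `w'` is constantly `w k`). -/
def adjHW {n : ℕ} (w w' : Fin n → Fin 3) : Prop :=
  ∃ k : Fin n, w k ≠ w' k ∧ (∀ m : Fin n, m < k → w m = w' m) ∧
    (∀ m : Fin n, k < m → w m = w' k) ∧ (∀ m : Fin n, k < m → w' m = w k)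

/-- The graph Laplacian of `H_n` as a matrix:
`Δf(w) = (1/3) Σ_{w' ∼ w} (f(w') - f(w))`; `H_n` is 3-regular once the loops at
the three constant words are counted, and a loop contributes `0` to the sum. -/
def lapHW (n : ℕ) : Matrix (Fin n → Fin 3) (Fin n → Fin 3) ℝ :=
  Matrix.of fun w w' =>
    (3 : ℝ)⁻¹ * ((if adjHW w w' then 1 else 0) -
      (if w' = w then ∑ u : Fin n → Fin 3, (if adjHW w u then (1 : ℝ) else 0) else 0))

/-- Spectral decimation polynomial for the Hanoi graphs. -/
def RH : ℝ → ℝ := fun z => z * (3 * z + 5)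

namespace Hanoi

open Module Module.End

section Combinatorics

variable {n : ℕ}

/-- `Swap w w'`: the words `w, w'` of length `n + 1` are joined by an edge of the Hanoi graph that
changes a letter other than the last one. -/
def Swap (w w' : Fin (n + 1) → Fin 3) : Prop :=
  ∃ k : Fin n, w k.castSucc ≠ w' k.castSucc ∧
    (∀ m, m < k.castSucc → w m = w' m) ∧
    (∀ m, k.castSucc < m → w m = w' k.castSucc) ∧ (∀ m, k.castSucc < m → w' m = w k.castSucc)

lemma Swap.symm {w w' : Fin (n + 1) → Fin 3} (h : Swap w w') : Swap w' w := by
  obtain ⟨k, h₁, h₂, h₃, h₄⟩ := h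
  exact ⟨k, h₁.symm, fun m hm => (h₂ m hm).symm, h₄, h₃⟩

lemma Swap.init_ne {w w' : Fin (n + 1) → Fin 3} (h : Swap w w') : Fin.init w ≠ Fin.init w' := by
  obtain ⟨k, h₁, -⟩ := h
  exact fun h => h₁ (congrFun h k)

lemma Swap.unique {w w₁ w₂ : Fin (n + 1) → Fin 3} (h₁ : Swap w w₁) (h₂ : Swap w w₂) :
    w₁ = w₂ := by
  obtain ⟨k, a₁, a₂, a₃, a₄⟩ := h₁
  obtain ⟨l, b₁, b₂, b₃, b₄⟩ := h₂
  have ka := a₃ _ (Fin.castSucc_lt_last k)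
  have lb := b₃ _ (Fin.castSucc_lt_last l)
  have hkl : k = l := by
    rcases lt_trichotomy k l with h | h | h
    · have := a₃ l.castSucc (Fin.castSucc_lt_castSucc_iff.2 h)
      exact absurd (this.trans (ka.symm.trans lb)) b₁
    · exact h
    · have := b₃ k.castSucc (Fin.castSucc_lt_castSucc_iff.2 h)
      exact absurd (this.trans (lb.symm.trans ka)) a₁
  subst hkl
  funext m
  rcases lt_trichotomy m k.castSucc with h | h | h
  · rw [← a₂ m h, b₂ m h]
  · rw [h, ← ka, lb]
  · rw [a₄ m h, b₄ m h]

lemma exists_swap_iff {w : Fin (n + 1) → Fin 3} :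
    (∃ w', Swap w w') ↔ ∃ m, w m ≠ w (Fin.last n) := by
  constructor
  · rintro ⟨w', k, h₁, -, h₃, -⟩
    exact ⟨k.castSucc, by rwa [h₃ _ (Fin.castSucc_lt_last k)]⟩
  · intro h
    obtain ⟨m, hm⟩ := (Set.toFinite {m | w m ≠ w (Fin.last n)}).exists_maximal h
    have hmax : ∀ j, m < j → w j = w (Fin.last n) := fun j hj => by
      by_contra hne
      exact absurd (hm.2 hne hj.le) (not_le.2 hj)
    obtain ⟨k, rfl⟩ : ∃ k : Fin n, m = k.castSucc := by
      refine ⟨m.castPred fun h => hm.1 (by rw [h]), by simp⟩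
    refine ⟨fun j => if j < k.castSucc then w j else
      if j = k.castSucc then w (Fin.last n) else w k.castSucc, k, ?_, ?_, ?_, ?_⟩
    · simpa using hm.1
    · intro j hj
      simp [hj]
    · intro j hj
      simpa using hmax j hj
    · intro j hj
      simp [hj.not_gt, hj.ne']

/-- The involution moving a word along its edge outside its triangle; words at a corner, where that
edge is a loop, are fixed. -/
def cross (w : Fin (n + 1) → Fin 3) : Fin (n + 1) → Fin 3 :=
  if h : ∃ w', Swap w w' then h.choose else w

lemma cross_eq_of_swap {w w' : Fin (n + 1) → Fin 3} (h : Swap w w') : cross w = w' := by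
  have h' : ∃ w', Swap w w' := ⟨w', h⟩
  rw [cross, dif_pos h']
  exact h'.choose_spec.unique h

lemma swap_cross_or (w : Fin (n + 1) → Fin 3) : Swap w (cross w) ∨ cross w = w := by
  by_cases h : ∃ w', Swap w w'
  · obtain ⟨w', h⟩ := h
    exact Or.inl (by rwa [cross_eq_of_swap h])
  · exact Or.inr (by rw [cross, dif_neg h])

lemma cross_eq_iff_swap {w w' : Fin (n + 1) → Fin 3} (hne : w' ≠ w) :
    cross w = w' ↔ Swap w w' := by
  refine ⟨fun h => ?_, cross_eq_of_swap⟩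
  rcases swap_cross_or w with h' | h'
  · rwa [h] at h'
  · exact absurd (h.symm.trans h') hne

lemma cross_involutive : Function.Involutive (cross : (Fin (n + 1) → Fin 3) → _) := by
  intro w
  rcases swap_cross_or w with h | h
  · exact cross_eq_of_swap h.symm
  · rw [h, h]

lemma cross_eq_self_iff {w : Fin (n + 1) → Fin 3} :
    cross w = w ↔ ∀ m, w m = w (Fin.last n) := by
  have h := exists_swap_iff (w := w)
  constructor
  · intro hw m
    by_contra hm
    obtain ⟨w', hw'⟩ := h.2 ⟨m, hm⟩
    exact hw'.init_ne (by rw [← cross_eq_of_swap hw', hw])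
  · intro hw
    rw [cross, dif_neg]
    rw [h]
    push Not
    exact hw

lemma card_cross_fixed : Fintype.card {w : Fin (n + 1) → Fin 3 // cross w = w} = 3 := by
  refine (Fintype.card_congr (β := Fin 3) ⟨fun w => w.1 (Fin.last n),
    fun a => ⟨fun _ => a, cross_eq_self_iff.2 fun _ => rfl⟩, ?_, ?_⟩).trans (Fintype.card_fin 3)
  · rintro ⟨w, hw⟩
    ext m
    simp [cross_eq_self_iff.1 hw m]
  · intro a
    rfl

lemma adjHW_succ_iff {w w' : Fin (n + 1) → Fin 3} :
    adjHW w w' ↔ w' ≠ w ∧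
      ((∃ b, (Fin.snoc (Fin.init w) b : Fin (n + 1) → Fin 3) = w') ∨ cross w = w') := by
  constructor
  · rintro ⟨k, h₁, h₂, h₃, h₄⟩
    have hne : w' ≠ w := fun h => h₁ (by rw [h])
    refine ⟨hne, ?_⟩
    induction k using Fin.lastCases with
    | last =>
      refine Or.inl ⟨w' (Fin.last n), ?_⟩
      have : Fin.init w = Fin.init w' := by
        funext m
        exact h₂ _ (Fin.castSucc_lt_last m)
      rw [this, Fin.snoc_init_self]
    | cast k => exact Or.inr (cross_eq_of_swap ⟨k, h₁, h₂, h₃, h₄⟩)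
  · rintro ⟨hne, ⟨b, rfl⟩ | h⟩
    · refine ⟨Fin.last n, ?_, ?_, ?_, ?_⟩
      · intro h
        apply hne
        rw [← h.trans (Fin.snoc_last ..), Fin.snoc_init_self]
      · intro m hm
        induction m using Fin.lastCases with
        | last => exact absurd hm (lt_irrefl _)
        | cast m => simp [Fin.init]
      · intro m hm
        exact absurd hm (Fin.le_last m).not_gt
      · intro m hm
        exact absurd hm (Fin.le_last m).not_gt
    · obtain ⟨k, h⟩ := (cross_eq_iff_swap hne).1 h
      exact ⟨k.castSucc, h⟩

/-- The edges of `H_n` at `v`, other than loops, are the edges of `H_{n+1}` leaving the triangle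
over `v`. -/
lemma adjHW_iff_cross {v v' : Fin n → Fin 3} :
    adjHW v v' ↔ v' ≠ v ∧ ∃ a, Fin.init (cross (Fin.snoc v a : Fin (n + 1) → Fin 3)) = v' := by
  constructor
  · rintro ⟨k, h₁, h₂, h₃, h₄⟩
    refine ⟨fun h => h₁ (by rw [h]), v' k, ?_⟩
    have : Swap (Fin.snoc v (v' k) : Fin (n + 1) → Fin 3) (Fin.snoc v' (v k)) := by
      refine ⟨k, by simpa using h₁, ?_, ?_, ?_⟩
      · intro m hm
        induction m using Fin.lastCases with
        | last => exact absurd hm (Fin.le_last _).not_gt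
        | cast m => simpa using h₂ m (by simpa using hm)
      · intro m hm
        induction m using Fin.lastCases with
        | last => simp
        | cast m => simpa using h₃ m (by simpa using hm)
      · intro m hm
        induction m using Fin.lastCases with
        | last => simp
        | cast m => simpa using h₄ m (by simpa using hm)
    rw [cross_eq_of_swap this, Fin.init_snoc]
  · rintro ⟨hne, a, rfl⟩
    rcases swap_cross_or (Fin.snoc v a : Fin (n + 1) → Fin 3) with h | h
    · obtain ⟨k, h₁, h₂, h₃, h₄⟩ := h
      refine ⟨k, by simpa [Fin.init] using h₁, fun m hm => ?_, fun m hm => ?_, fun m hm => ?_⟩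
      · simpa [Fin.init] using h₂ m.castSucc (by simpa using hm)
      · simpa [Fin.init] using h₃ m.castSucc (by simpa using hm)
      · simpa [Fin.init] using h₄ m.castSucc (by simpa using hm)
    · exact absurd (by rw [h, Fin.init_snoc]) hne

lemma eq_of_init_cross_eq {v : Fin n → Fin 3} {a b : Fin 3}
    (h : Fin.init (cross (Fin.snoc v a : Fin (n + 1) → Fin 3)) =
      Fin.init (cross (Fin.snoc v b : Fin (n + 1) → Fin 3)))
    (hne : Fin.init (cross (Fin.snoc v a : Fin (n + 1) → Fin 3)) ≠ v) : a = b := by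
  rcases swap_cross_or (Fin.snoc v a : Fin (n + 1) → Fin 3) with ha | ha
  swap
  · exact absurd (by rw [ha, Fin.init_snoc]) hne
  rcases swap_cross_or (Fin.snoc v b : Fin (n + 1) → Fin 3) with hb | hb
  swap
  · exact absurd (by rw [h, hb, Fin.init_snoc]) hne
  obtain ⟨k, a₁, a₂, a₃, a₄⟩ := ha
  obtain ⟨l, b₁, b₂, b₃, b₄⟩ := hb
  have hk : ∀ m : Fin n, cross (Fin.snoc v a : Fin (n + 1) → Fin 3) m.castSucc =
    cross (Fin.snoc v b : Fin (n + 1) → Fin 3) m.castSucc := fun m => congrFun h m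
  have hkl : k = l := by
    rcases lt_trichotomy k l with hlt | hlt | hlt
    · refine absurd ?_ a₁
      rw [hk, ← b₂ k.castSucc (by simpa using hlt)]
      simp
    · exact hlt
    · refine absurd ?_ b₁
      rw [← hk, ← a₂ l.castSucc (by simpa using hlt)]
      simp
  subst hkl
  have h₁ := a₃ _ (Fin.castSucc_lt_last k)
  have h₂ := b₃ _ (Fin.castSucc_lt_last k)
  rw [Fin.snoc_last] at h₁ h₂
  rw [h₁, h₂, hk]

/-- If `φ` enumerates the neighbours of `v`, repeating only `v` itself, then the sum of differences
over the neighbours is the sum over the enumeration. -/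
lemma sum_adj_sub_eq {V α : Type*} [Fintype V] [Fintype α] {r : V → Prop} {v : V} (φ : α → V)
    (hr : ∀ v', r v' ↔ v' ≠ v ∧ ∃ a, φ a = v')
    (hφ : ∀ a b, φ a = φ b → φ a ≠ v → a = b) (f : V → ℝ) :
    ∑ v', (if r v' then f v' - f v else 0) = ∑ a, (f (φ a) - f v) := by
  rw [← Finset.sum_filter]
  have : ∑ a, (f (φ a) - f v) = ∑ a with φ a ≠ v, (f (φ a) - f v) := by
    rw [Finset.sum_filter]
    refine Finset.sum_congr rfl fun a _ => ?_
    by_cases h : φ a = v <;> simp [h]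
  rw [this]
  symm
  refine Finset.sum_bij (fun a _ => φ a) ?_ ?_ ?_ ?_
  · intro a ha
    simp only [Finset.mem_filter, Finset.mem_univ, true_and] at ha ⊢
    exact (hr _).2 ⟨ha, a, rfl⟩
  · intro a ha b _ h
    simp only [Finset.mem_filter, Finset.mem_univ, true_and] at ha
    exact hφ a b h ha
  · intro w hw
    simp only [Finset.mem_filter, Finset.mem_univ, true_and] at hw
    obtain ⟨hne, a, rfl⟩ := (hr _).1 hw
    exact ⟨a, by simpa using hne, rfl⟩
  · intros
    rfl

end Combinatorics

section Operators

variable {n : ℕ}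

/-- The Laplacian of `H_n` as an endomorphism. -/
abbrev lap (n : ℕ) : End ℝ ((Fin n → Fin 3) → ℝ) := Matrix.mulVecLin (lapHW n)

/-- Sum over each triangle of `H_{n+1}`. -/
def push (n : ℕ) : ((Fin (n + 1) → Fin 3) → ℝ) →ₗ[ℝ] ((Fin n → Fin 3) → ℝ) :=
  ∑ a : Fin 3, LinearMap.funLeft ℝ ℝ fun v => Fin.snoc v a

/-- Extension of a function on `H_n` constantly over each triangle of `H_{n+1}`. -/
def pull (n : ℕ) : ((Fin n → Fin 3) → ℝ) →ₗ[ℝ] ((Fin (n + 1) → Fin 3) → ℝ) :=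
  LinearMap.funLeft ℝ ℝ Fin.init

/-- Composition with `cross`. -/
def flip (n : ℕ) : End ℝ ((Fin (n + 1) → Fin 3) → ℝ) := LinearMap.funLeft ℝ ℝ cross

lemma push_apply (f : (Fin (n + 1) → Fin 3) → ℝ) (v : Fin n → Fin 3) :
    push n f v = ∑ a : Fin 3, f (Fin.snoc v a) := by
  simp [push, LinearMap.sum_apply, Finset.sum_apply, LinearMap.funLeft_apply]

lemma pull_apply (g : (Fin n → Fin 3) → ℝ) (w : Fin (n + 1) → Fin 3) :
    pull n g w = g (Fin.init w) := rfl

lemma flip_apply (f : (Fin (n + 1) → Fin 3) → ℝ) (w : Fin (n + 1) → Fin 3) :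
    flip n f w = f (cross w) := rfl

lemma lap_apply (f : (Fin n → Fin 3) → ℝ) (w : Fin n → Fin 3) :
    lap n f w = 3⁻¹ * ∑ w', (if adjHW w w' then f w' - f w else 0) := by
  rw [Matrix.mulVecLin_apply, Matrix.mulVec, dotProduct]
  simp only [lapHW, Matrix.of_apply, mul_assoc, sub_mul, ite_mul, one_mul, zero_mul]
  rw [← Finset.mul_sum, Finset.sum_sub_distrib, Finset.sum_ite_eq' Finset.univ w]
  simp only [Finset.mem_univ, if_true, Finset.sum_mul]
  rw [← Finset.sum_sub_distrib]
  congr 1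
  refine Finset.sum_congr rfl fun w' _ => ?_
  split_ifs <;> simp

lemma lap_zero : lap 0 = 0 := by
  ext f w
  rw [LinearMap.comp_apply, lap_apply]
  have : ∀ w' : Fin 0 → Fin 3, ¬ adjHW w w' := fun w' ⟨k, _⟩ => k.elim0
  simp [this]

lemma push_pull (g : (Fin n → Fin 3) → ℝ) : push n (pull n g) = (3 : ℝ) • g := by
  ext v
  simp [push_apply, pull_apply]

lemma flip_flip (f : (Fin (n + 1) → Fin 3) → ℝ) : flip n (flip n f) = f := by
  ext w
  simp [flip_apply, cross_involutive w]

lemma lap_succ (f : (Fin (n + 1) → Fin 3) → ℝ) :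
    (3 : ℝ) • lap (n + 1) f = pull n (push n f) + flip n f - (4 : ℝ) • f := by
  ext w
  have h := sum_adj_sub_eq (r := adjHW w) (v := w)
    (fun b : Option (Fin 3) => b.elim (cross w) fun b => Fin.snoc (Fin.init w) b)
    (fun w' => by rw [adjHW_succ_iff, Option.exists]; simp [or_comm]) ?_ f
  · simp only [Pi.smul_apply, Pi.add_apply, Pi.sub_apply, smul_eq_mul, lap_apply, h,
      Fintype.sum_option, pull_apply, push_apply, flip_apply, Option.elim, Finset.sum_sub_distrib,
      Finset.sum_const, Finset.card_univ, Fintype.card_option, Fintype.card_fin, nsmul_eq_mul]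
    push_cast
    ring
  · have key : ∀ b, cross w = Fin.snoc (Fin.init w) b → cross w = w := fun b hb => by
      rcases swap_cross_or w with h | h
      · exact absurd (by rw [hb, Fin.init_snoc]) h.init_ne
      · exact h
    rintro (_ | a) (_ | b) h hne
    · rfl
    · exact absurd (key b h) hne
    · exact absurd (h.trans (key a h.symm)) hne
    · refine congrArg some ?_
      simpa using congrFun h (Fin.last n)

lemma push_flip_pull (g : (Fin n → Fin 3) → ℝ) :
    push n (flip n (pull n g)) = (3 : ℝ) • lap n g + (3 : ℝ) • g := by
  ext v
  have h := sum_adj_sub_eq (r := adjHW v) (v := v)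
    (fun a : Fin 3 => Fin.init (cross (Fin.snoc v a : Fin (n + 1) → Fin 3)))
    (fun _ => adjHW_iff_cross) (fun _ _ => eq_of_init_cross_eq) g
  simp only [Pi.smul_apply, Pi.add_apply, smul_eq_mul, lap_apply, h, pull_apply, push_apply,
    flip_apply, Finset.sum_sub_distrib, Finset.sum_const, Finset.card_univ, Fintype.card_fin,
    nsmul_eq_mul]
  push_cast
  ring

lemma trace_flip (n : ℕ) : LinearMap.trace ℝ _ (flip n) = 3 := by
  rw [LinearMap.trace_eq_matrix_trace ℝ (Pi.basisFun ℝ (Fin (n + 1) → Fin 3)), Matrix.trace]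
  have : ∀ w : Fin (n + 1) → Fin 3, LinearMap.toMatrix (Pi.basisFun ℝ (Fin (n + 1) → Fin 3))
      (Pi.basisFun ℝ (Fin (n + 1) → Fin 3)) (flip n) w w = if cross w = w then 1 else 0 := by
    intro w
    rw [LinearMap.toMatrix_apply]
    simp [flip_apply, Pi.single_apply]
  simp only [Matrix.diag_apply, this]
  rw [Finset.sum_boole, ← Fintype.card_subtype]
  have := card_cross_fixed (n := n)
  norm_cast

lemma two_mul_finrank_eigenspace_of_involution {E : Type*} [AddCommGroup E] [Module ℝ E]
    [FiniteDimensional ℝ E] (S : End ℝ E) (hS : ∀ f, S (S f) = f) (ε : ℝ) (hε : ε * ε = 1) :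
    2 * (finrank ℝ (eigenspace S ε) : ℝ) = finrank ℝ E + ε * LinearMap.trace ℝ E S := by
  have hp : LinearMap.IsProj (eigenspace S ε) ((2⁻¹ : ℝ) • (LinearMap.id + ε • S)) := by
    constructor
    · intro f
      rw [mem_eigenspace_iff]
      simp only [LinearMap.smul_apply, LinearMap.add_apply, LinearMap.id_apply, map_smul, map_add,
        hS]
      have h : ε • ε • S f = S f := by rw [smul_smul, hε, one_smul]
      linear_combination (norm := module) (-(2⁻¹ : ℝ)) • h
    · intro f hf
      rw [mem_eigenspace_iff] at hf
      simp only [LinearMap.smul_apply, LinearMap.add_apply, LinearMap.id_apply, hf, smul_smul, hε]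
      module
  have h := hp.trace
  rw [map_smul, map_add, map_smul, LinearMap.trace_id] at h
  rw [← h]
  simp only [smul_eq_mul]
  ring

end Operators

section Decimation

variable {n : ℕ}

lemma lap_succ_eq_smul_iff {f : (Fin (n + 1) → Fin 3) → ℝ} {z : ℝ} :
    lap (n + 1) f = z • f ↔ pull n (push n f) + flip n f = (3 * z + 4) • f := by
  have h := lap_succ f
  constructor
  · intro hf
    rw [hf] at h
    linear_combination (norm := module) -h
  · intro hf
    rw [hf] at h
    linear_combination (norm := module) (3⁻¹ : ℝ) • h

lemma lap_push {f : (Fin (n + 1) → Fin 3) → ℝ} {z : ℝ} (hf : lap (n + 1) f = z • f) :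
    lap n (push n f) = RH z • push n f := by
  rw [lap_succ_eq_smul_iff] at hf
  have h₁ := congrArg (push n) hf
  have h₂ := congrArg (push n ∘ flip n) hf
  simp only [Function.comp_apply, map_add, map_smul, push_pull, flip_flip, push_flip_pull]
    at h₁ h₂
  rw [RH]
  linear_combination (norm := module) (3⁻¹ : ℝ) • h₂ + ((3 * z + 4) / 3) • h₁

lemma eq_zero_of_push_eq_zero {f : (Fin (n + 1) → Fin 3) → ℝ} {z : ℝ} (h₁ : z ≠ -1)
    (h₂ : z ≠ -5 / 3) (hf : lap (n + 1) f = z • f) (h : push n f = 0) : f = 0 := by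
  rw [lap_succ_eq_smul_iff, h, map_zero, zero_add] at hf
  have h' := flip_flip f
  rw [hf, map_smul, hf] at h'
  have h₃ : (3 * (z + 1) * (3 * z + 5)) • f = 0 := by
    linear_combination (norm := module) h'
  refine (smul_eq_zero.1 h₃).resolve_left (mul_ne_zero (mul_ne_zero three_ne_zero ?_) ?_)
  · exact fun h => h₁ (by linarith)
  · exact fun h => h₂ (by linarith)

/-- Spectral decimation: away from the exceptional values `-1` and `-5/3`, the eigenspaces of
`H_{n+1}` and of `H_n` correspond under `RH`. -/
lemma finrank_eigenspace_succ {z : ℝ} (h₁ : z ≠ -1) (h₂ : z ≠ -5 / 3) :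
    finrank ℝ (eigenspace (lap (n + 1)) z) = finrank ℝ (eigenspace (lap n) (RH z)) := by
  have hmap : ∀ f ∈ eigenspace (lap (n + 1)) z, push n f ∈ eigenspace (lap n) (RH z) :=
    fun f hf => mem_eigenspace_iff.2 (lap_push (mem_eigenspace_iff.1 hf))
  refine (LinearEquiv.ofBijective ((push n).restrict hmap) ⟨?_, ?_⟩).finrank_eq
  · rw [injective_iff_map_eq_zero]
    rintro ⟨f, hf⟩ h
    exact Subtype.ext (eq_zero_of_push_eq_zero h₁ h₂ (mem_eigenspace_iff.1 hf)
      (congrArg Subtype.val h))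
  · rintro ⟨g, hg⟩
    rw [mem_eigenspace_iff] at hg
    have hz : 3 * (z + 1) * (3 * z + 5) ≠ 0 := by
      refine mul_ne_zero (mul_ne_zero three_ne_zero ?_) ?_
      · exact fun h => h₁ (by linarith)
      · exact fun h => h₂ (by linarith)
    have hpush : push n ((3 * z + 4) • pull n g + flip n (pull n g)) =
        (3 * (z + 1) * (3 * z + 5)) • g := by
      rw [map_add, map_smul, push_pull, push_flip_pull, hg, RH]
      module
    refine ⟨⟨(3 * (z + 1) * (3 * z + 5))⁻¹ • ((3 * z + 4) • pull n g + flip n (pull n g)), ?_⟩,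
      Subtype.ext ?_⟩
    · refine Submodule.smul_mem _ _ ?_
      rw [mem_eigenspace_iff, lap_succ_eq_smul_iff, hpush]
      simp only [map_add, map_smul, flip_flip]
      module
    · change push n ((3 * (z + 1) * (3 * z + 5))⁻¹ • ((3 * z + 4) • pull n g + flip n (pull n g))) = g
      rw [map_smul, hpush, inv_smul_smul₀ hz]

lemma finrank_eigenspace_exceptional {ε : ℝ} (hε : ε * ε = 1)
    (h : ∀ f, lap (n + 1) f = ((ε - 4) / 3) • f → push n f = 0) :
    2 * (finrank ℝ (eigenspace (lap (n + 1)) ((ε - 4) / 3)) : ℝ) +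
      2 * finrank ℝ ((eigenspace (flip n) ε).map (push n)) = 3 ^ (n + 1) + ε * 3 := by
  have h₁ := two_mul_finrank_eigenspace_of_involution (flip n) flip_flip ε hε
  rw [trace_flip] at h₁
  have h₂ := LinearMap.finrank_range_add_finrank_ker ((push n).domRestrict (eigenspace (flip n) ε))
  have h₃ : (LinearMap.ker ((push n).domRestrict (eigenspace (flip n) ε))).map
      (Submodule.subtype _) = eigenspace (lap (n + 1)) ((ε - 4) / 3) := by
    ext f
    simp only [Submodule.mem_map, LinearMap.mem_ker, LinearMap.domRestrict_apply,
      Submodule.subtype_apply, Subtype.exists, mem_eigenspace_iff, exists_and_left,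
      exists_prop, exists_eq_right_right]
    have hc : 3 * ((ε - 4) / 3) + 4 = ε := by ring
    constructor
    · rintro ⟨hf, hf'⟩
      rw [lap_succ_eq_smul_iff, hf, map_zero, zero_add, hf', hc]
    · intro hf
      have h0 := h f hf
      rw [lap_succ_eq_smul_iff, h0, map_zero, zero_add, hc] at hf
      exact ⟨h0, hf⟩
  rw [← Submodule.finrank_map_subtype_eq, h₃, LinearMap.range_domRestrict] at h₂
  rw [← h₂] at h₁
  have hE : (finrank ℝ ((Fin (n + 1) → Fin 3) → ℝ) : ℝ) = 3 ^ (n + 1) := by simp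
  rw [hE] at h₁
  push_cast at h₁
  linarith

lemma self_add_smul_flip_mem {ε : ℝ} (hε : ε * ε = 1) (f : (Fin (n + 1) → Fin 3) → ℝ) :
    f + ε • flip n f ∈ eigenspace (flip n) ε := by
  rw [mem_eigenspace_iff, map_add, map_smul, flip_flip, smul_add, smul_smul, hε, one_smul]
  abel

lemma RH_pos {z : ℝ} (hz : 0 < z) : 0 < RH z := by
  rw [RH]
  positivity

lemma eigenspace_zero_of_ne {z : ℝ} (hz : z ≠ 0) : finrank ℝ (eigenspace (lap 0) z) = 0 := by
  rw [Submodule.finrank_eq_zero, Submodule.eq_bot_iff]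
  intro f hf
  rw [mem_eigenspace_iff, lap_zero, LinearMap.zero_apply] at hf
  exact (smul_eq_zero.1 hf.symm).resolve_left hz

lemma finrank_eigenspace_of_pos (n : ℕ) {z : ℝ} (hz : 0 < z) :
    finrank ℝ (eigenspace (lap n) z) = 0 := by
  induction n generalizing z with
  | zero => exact eigenspace_zero_of_ne hz.ne'
  | succ n ih =>
    rw [finrank_eigenspace_succ (by linarith) (by linarith)]
    exact ih (RH_pos hz)

lemma finrank_eigenspace_neg_two (n : ℕ) : finrank ℝ (eigenspace (lap n) (-2)) = 0 := by
  cases n with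
  | zero => exact eigenspace_zero_of_ne (by norm_num)
  | succ n =>
    rw [finrank_eigenspace_succ (by norm_num) (by norm_num)]
    exact finrank_eigenspace_of_pos n (by norm_num [RH])

lemma finrank_eigenspace_zero (n : ℕ) : finrank ℝ (eigenspace (lap n) 0) = 1 := by
  induction n with
  | zero =>
    rw [lap_zero, eigenspace_zero, LinearMap.ker_zero, finrank_top]
    simp
  | succ n ih =>
    rw [finrank_eigenspace_succ (by norm_num) (by norm_num), RH, zero_mul, ih]

lemma finrank_eigenspace_neg_one (n : ℕ) :
    finrank ℝ (eigenspace (lap (n + 1)) (-1)) = (3 ^ n + 3) / 2 := by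
  have hbot : eigenspace (lap n) (-2) = ⊥ :=
    Submodule.finrank_eq_zero.1 (finrank_eigenspace_neg_two n)
  have h := finrank_eigenspace_exceptional (n := n) (ε := 1) (by norm_num) fun f hf => by
    have := lap_push hf
    rw [show RH ((1 - 4) / 3) = -2 by norm_num [RH]] at this
    rwa [← Submodule.mem_bot ℝ, ← hbot, mem_eigenspace_iff]
  have htop : (eigenspace (flip n) 1).map (push n) = ⊤ := by
    rw [eq_top_iff]
    have hinj : Function.Injective (lap n + (2 : ℝ) • LinearMap.id : End ℝ ((Fin n → Fin 3) → ℝ)) := by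
      rw [injective_iff_map_eq_zero]
      intro g hg
      rw [← Submodule.mem_bot ℝ, ← hbot, mem_eigenspace_iff]
      simp only [LinearMap.add_apply, LinearMap.smul_apply, LinearMap.id_apply] at hg
      linear_combination (norm := module) hg
    intro g _
    obtain ⟨h, rfl⟩ := LinearMap.injective_iff_surjective.1 hinj g
    refine ⟨_, Submodule.smul_mem _ (3⁻¹ : ℝ) (self_add_smul_flip_mem (one_mul 1) (pull n h)), ?_⟩
    simp only [map_add, map_smul, push_pull, push_flip_pull, LinearMap.add_apply,
      LinearMap.smul_apply, LinearMap.id_apply]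
    module
  rw [htop, finrank_top, show ((1 : ℝ) - 4) / 3 = -1 by norm_num] at h
  have hF : (finrank ℝ ((Fin n → Fin 3) → ℝ) : ℝ) = 3 ^ n := by simp
  rw [hF, pow_succ] at h
  have h' : 2 * finrank ℝ (eigenspace (lap (n + 1)) (-1)) = 3 ^ n + 3 := by
    have : (2 * finrank ℝ (eigenspace (lap (n + 1)) (-1)) : ℝ) = 3 ^ n + 3 := by linarith
    exact_mod_cast this
  omega

lemma sum_push (f : (Fin (n + 1) → Fin 3) → ℝ) : ∑ v, push n f v = ∑ w, f w := by
  simp only [push_apply]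
  rw [Finset.sum_comm, ← (Fin.snocEquiv fun _ => Fin 3).sum_comp, Fintype.sum_prod_type]
  rfl

lemma sum_flip (f : (Fin (n + 1) → Fin 3) → ℝ) : ∑ w, flip n f w = ∑ w, f w :=
  Equiv.sum_comp (cross_involutive.toPerm (cross (n := n))) f

lemma lap_const (n : ℕ) : lap n (fun _ => 1) = 0 := by
  ext w
  simp [lap_apply]

lemma eq_zero_of_lap_eq_zero {g : (Fin n → Fin 3) → ℝ} (hg : lap n g = 0) (hs : ∑ v, g v = 0) :
    g = 0 := by
  have h1 : (fun _ => 1 : (Fin n → Fin 3) → ℝ) ∈ eigenspace (lap n) 0 := by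
    rw [mem_eigenspace_iff, lap_const, zero_smul]
  have hg' : g ∈ eigenspace (lap n) 0 := by
    rw [mem_eigenspace_iff, hg, zero_smul]
  obtain ⟨c, hc⟩ := (finrank_eq_one_iff_of_nonzero' (⟨_, h1⟩ : eigenspace (lap n) 0) (fun h =>
    one_ne_zero (congrFun (congrArg Subtype.val h) fun _ => 0))).1 (finrank_eigenspace_zero n)
    ⟨g, hg'⟩
  have hc' : g = c • fun _ => 1 := (congrArg Subtype.val hc).symm
  subst hc'
  have : c = 0 := by simpa using hs
  rw [this, zero_smul]

lemma finrank_eigenspace_neg_five_thirds (n : ℕ) :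
    finrank ℝ (eigenspace (lap (n + 1)) (-5 / 3)) = (3 ^ n - 1) / 2 := by
  have h := finrank_eigenspace_exceptional (n := n) (ε := -1) (by norm_num) fun f hf => by
    have h0 := lap_push hf
    rw [show RH ((-1 - 4) / 3) = 0 by norm_num [RH], zero_smul] at h0
    refine eq_zero_of_lap_eq_zero h0 ?_
    rw [lap_succ_eq_smul_iff] at hf
    have h1 := congrArg (fun f : (Fin (n + 1) → Fin 3) → ℝ => ∑ w, f w) hf
    simp only [Pi.add_apply, Pi.smul_apply, Finset.sum_add_distrib, sum_flip, smul_eq_mul,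
      ← Finset.mul_sum] at h1
    rw [← sum_push (pull n (push n f)), push_pull, ← sum_push f] at h1
    simp only [Pi.smul_apply, smul_eq_mul, ← Finset.mul_sum] at h1
    ring_nf at h1
    linarith
  have hF : finrank ℝ ((Fin n → Fin 3) → ℝ) = 3 ^ n := by simp
  have hle : LinearMap.range (lap n) ≤ (eigenspace (flip n) (-1)).map (push n) := by
    rintro _ ⟨g, rfl⟩
    refine ⟨_, Submodule.smul_mem _ (-3⁻¹ : ℝ) (self_add_smul_flip_mem (by norm_num) (pull n g)), ?_⟩
    simp only [map_add, map_smul, push_pull, push_flip_pull]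
    module
  have hlt : (eigenspace (flip n) (-1)).map (push n) < ⊤ := by
    rw [lt_top_iff_ne_top]
    intro htop
    obtain ⟨f, hf, hf'⟩ : (fun _ => 1 : (Fin n → Fin 3) → ℝ) ∈
      (eigenspace (flip n) (-1)).map (push n) := htop ▸ Submodule.mem_top
    have h1 := sum_push f
    have h2 := sum_flip f
    rw [hf'] at h1
    rw [mem_eigenspace_iff.1 hf] at h2
    simp only [Pi.smul_apply, smul_eq_mul, ← Finset.mul_sum, ← h1] at h2
    simp only [Finset.sum_const, Finset.card_univ, nsmul_eq_mul, mul_one] at h2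
    have : (0 : ℝ) < Fintype.card (Fin n → Fin 3) := by exact_mod_cast Fintype.card_pos
    linarith
  have h1 := Submodule.finrank_mono hle
  have h2 := Submodule.finrank_lt_finrank_of_lt hlt
  have h3 := LinearMap.finrank_range_add_finrank_ker (lap n)
  rw [← eigenspace_zero, finrank_eigenspace_zero, hF] at h3
  rw [finrank_top, hF] at h2
  have h4 : finrank ℝ ((eigenspace (flip n) (-1)).map (push n)) + 1 = 3 ^ n := by omega
  rw [show ((-1 : ℝ) - 4) / 3 = -5 / 3 by norm_num, pow_succ, ← Nat.cast_ofNat (R := ℝ) (n := 3),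
    ← Nat.cast_pow, ← h4] at h
  have h5 : 2 * finrank ℝ (eigenspace (lap (n + 1)) (-5 / 3)) + 1 = 3 ^ n := by
    rw [← h4]
    push_cast at h
    have : (2 * finrank ℝ (eigenspace (lap (n + 1)) (-5 / 3)) + 1 : ℝ) =
      finrank ℝ ((eigenspace (flip n) (-1)).map (push n)) + 1 := by linarith
    exact_mod_cast this
  omega

end Decimation

section Preimages

lemma RH_iterate_zero (i : ℕ) : RH^[i] 0 = 0 :=
  Function.iterate_fixed (by simp [RH]) i

lemma RH_iterate_pos (i : ℕ) {z : ℝ} (hz : 0 < z) : 0 < RH^[i] z := by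
  induction i generalizing z with
  | zero => exact hz
  | succ i ih => exact ih (RH_pos hz)

/-- Neither exceptional value is a proper iterated preimage of an exceptional value. -/
lemma ne_exceptional_of_iterate_succ {i : ℕ} {z a : ℝ} (ha : a = -1 ∨ a = -5 / 3)
    (h : RH^[i + 1] z = a) : z ≠ -1 ∧ z ≠ -5 / 3 := by
  rw [Function.iterate_succ_apply] at h
  constructor
  · rintro rfl
    rw [show RH (-1) = -2 by norm_num [RH]] at h
    cases i with
    | zero => rcases ha with rfl | rfl <;> norm_num at h
    | succ i =>
      have := RH_iterate_pos i (z := RH (-2)) (by norm_num [RH])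
      rw [Function.iterate_succ_apply] at h
      rcases ha with rfl | rfl <;> linarith
  · rintro rfl
    rw [show RH (-5 / 3) = 0 by norm_num [RH], RH_iterate_zero] at h
    rcases ha with rfl | rfl <;> norm_num at h

lemma finrank_eigenspace_of_iterate {a : ℝ} (ha : a = -1 ∨ a = -5 / 3) {n i : ℕ} {z : ℝ}
    (h : RH^[i] z = a) :
    finrank ℝ (eigenspace (lap (n + i)) z) = finrank ℝ (eigenspace (lap n) a) := by
  induction i generalizing z with
  | zero => rw [← h]; rfl
  | succ i ih =>
    obtain ⟨h₁, h₂⟩ := ne_exceptional_of_iterate_succ ha h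
    rw [← add_assoc, finrank_eigenspace_succ h₁ h₂]
    exact ih h

lemma RH_eq_iff {z y : ℝ} (hy : -5 / 3 ≤ y) :
    RH z = y ↔ z = (-5 + √(25 + 12 * y)) / 6 ∨ z = (-5 - √(25 + 12 * y)) / 6 := by
  have hs := Real.mul_self_sqrt (show 0 ≤ 25 + 12 * y by linarith)
  set s := √(25 + 12 * y)
  rw [← sub_eq_zero, show RH z - y = 3 * ((z - (-5 + s) / 6) * (z - (-5 - s) / 6)) by
    rw [RH]; linear_combination (1 / 12 : ℝ) * hs]
  simp [sub_eq_zero]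

lemma ncard_preimage_RH {s : Set ℝ} (hs : s ⊆ Set.Icc (-5 / 3) 0) (hfin : s.Finite) :
    (RH ⁻¹' s).ncard = 2 * s.ncard := by
  have hsq : ∀ y ∈ s, 0 < √(25 + 12 * y) := fun y hy =>
    Real.sqrt_pos.2 (by linarith [(hs hy).1])
  have hinj : ∀ x ∈ s, ∀ y ∈ s, √(25 + 12 * x) = √(25 + 12 * y) → x = y := fun x hx y hy h => by
    rw [Real.sqrt_inj (by linarith [(hs hx).1]) (by linarith [(hs hy).1])] at h
    linarith
  have hun : RH ⁻¹' s = (fun y => (-5 + √(25 + 12 * y)) / 6) '' s ∪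
      (fun y => (-5 - √(25 + 12 * y)) / 6) '' s := by
    ext z
    simp only [Set.mem_preimage, Set.mem_union, Set.mem_image]
    constructor
    · intro hz
      exact ((RH_eq_iff (hs hz).1).1 rfl).imp (fun h => ⟨_, hz, h.symm⟩) fun h => ⟨_, hz, h.symm⟩
    · rintro (⟨y, hy, h⟩ | ⟨y, hy, h⟩)
      · rwa [(RH_eq_iff (hs hy).1).2 (Or.inl h.symm)]
      · rwa [(RH_eq_iff (hs hy).1).2 (Or.inr h.symm)]
  rw [hun, Set.ncard_union_eq ?_ (hfin.image _) (hfin.image _), Set.InjOn.ncard_image,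
    Set.InjOn.ncard_image, two_mul]
  · exact fun x hx y hy h => hinj x hx y hy (by linarith)
  · exact fun x hx y hy h => hinj x hx y hy (by linarith)
  · rw [Set.disjoint_left]
    rintro _ ⟨x, hx, rfl⟩ ⟨y, hy, h⟩
    have := hsq x hx
    have := hsq y hy
    simp only at h
    linarith

lemma preimage_RH_subset {s : Set ℝ} (hs : s ⊆ Set.Icc (-5 / 3) 0) :
    RH ⁻¹' s ⊆ Set.Icc (-5 / 3) 0 := by
  intro z hz
  have h : z * (3 * z + 5) ≤ 0 := (hs hz).2
  constructor <;> nlinarith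

lemma ncard_iterate_preimage_RH {a : ℝ} (ha : a ∈ Set.Icc (-5 / 3 : ℝ) 0) (i : ℕ) :
    (RH^[i] ⁻¹' {a}).ncard = 2 ^ i ∧ RH^[i] ⁻¹' {a} ⊆ Set.Icc (-5 / 3) 0 := by
  induction i with
  | zero => simpa using ha
  | succ i ih =>
    rw [Function.iterate_succ, Set.preimage_comp]
    refine ⟨?_, preimage_RH_subset ih.2⟩
    rw [ncard_preimage_RH ih.2 (Set.finite_of_ncard_pos (by rw [ih.1]; positivity)), ih.1,
      pow_succ']

end Preimages

lemma hasEigenvalue_lap_iff {n : ℕ} {z : ℝ} :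
    HasEigenvalue (lap n) z ↔ finrank ℝ (eigenspace (lap n) z) ≠ 0 := by
  rw [hasEigenvalue_iff, Ne, Ne, Submodule.finrank_eq_zero]

lemma hasEigenvalue_lap_iff_iterate {n : ℕ} {z : ℝ} :
    HasEigenvalue (lap n) z ↔
      z = 0 ∨ (∃ i < n, RH^[i] z = -1) ∨ ∃ j, j + 2 ≤ n ∧ RH^[j] z = -5 / 3 := by
  rw [hasEigenvalue_lap_iff]
  constructor
  · intro h
    induction n generalizing z with
    | zero => exact Or.inl (by_contra fun hz => h (eigenspace_zero_of_ne hz))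
    | succ n ih =>
      by_cases h₁ : z = -1
      · exact Or.inr (Or.inl ⟨0, n.succ_pos, h₁⟩)
      by_cases h₂ : z = -5 / 3
      · refine Or.inr (Or.inr ⟨0, ?_, h₂⟩)
        rcases n with _ | n
        · subst h₂
          simp [finrank_eigenspace_neg_five_thirds] at h
        · omega
      rw [finrank_eigenspace_succ h₁ h₂] at h
      rcases ih h with h | ⟨i, hi, h⟩ | ⟨j, hj, h⟩
      · refine Or.inl ((mul_eq_zero.1 h).resolve_right fun h => h₂ (by linarith))
      · exact Or.inr (Or.inl ⟨i + 1, by omega, h⟩)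
      · exact Or.inr (Or.inr ⟨j + 1, by omega, h⟩)
  · rintro (rfl | ⟨i, hi, h⟩ | ⟨j, hj, h⟩)
    · simp [finrank_eigenspace_zero]
    · obtain ⟨m, rfl⟩ := Nat.exists_eq_add_of_lt hi
      rw [show i + m + 1 = m + 1 + i by omega, finrank_eigenspace_of_iterate (Or.inl rfl) h,
        finrank_eigenspace_neg_one]
      have : 0 < 3 ^ m := by positivity
      omega
    · obtain ⟨m, rfl⟩ := Nat.exists_eq_add_of_le hj
      rw [show j + 2 + m = m + 1 + 1 + j by omega, finrank_eigenspace_of_iterate (Or.inr rfl) h,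
        finrank_eigenspace_neg_five_thirds]
      have : 0 < 3 ^ m := by positivity
      rw [pow_succ]
      omega

end Hanoi

/-- The spectrum of `Δ^H_n`:
`σ(Δ^H_n) = {0} ∪ (∪_{i=0}^{n-1} R_H^{-i}(-1)) ∪ (∪_{j=0}^{n-2} R_H^{-j}(-5/3))`;
`0` has multiplicity `1`, each element of `R_H^{-i}(-1)` has multiplicity
`(3^{n-1-i}+3)/2`, each element of `R_H^{-j}(-5/3)` has multiplicity
`(3^{n-1-j}-1)/2`, and `R_H^{-i}(-1)`, `R_H^{-j}(-5/3)` contain `2^i` resp. `2^j`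
elements. -/
theorem H_spectrum (n : ℕ) :
    ({z : ℝ | Module.End.HasEigenvalue (Matrix.mulVecLin (lapHW n)) z}
      = {0} ∪ (⋃ i ∈ {i : ℕ | i < n}, (RH^[i]) ⁻¹' {(-1 : ℝ)})
          ∪ (⋃ j ∈ {j : ℕ | j + 2 ≤ n}, (RH^[j]) ⁻¹' {(-5/3 : ℝ)})) ∧
    Module.finrank ℝ (Module.End.eigenspace (Matrix.mulVecLin (lapHW n)) 0) = 1 ∧
    (∀ i < n, ∀ z ∈ (RH^[i]) ⁻¹' {(-1 : ℝ)},
      Module.finrank ℝ (Module.End.eigenspace (Matrix.mulVecLin (lapHW n)) z)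
        = (3 ^ (n - 1 - i) + 3) / 2) ∧
    (∀ i < n, Nat.card ((RH^[i]) ⁻¹' {(-1 : ℝ)} : Set ℝ) = 2 ^ i) ∧
    (∀ j, j + 2 ≤ n → ∀ z ∈ (RH^[j]) ⁻¹' {(-5/3 : ℝ)},
      Module.finrank ℝ (Module.End.eigenspace (Matrix.mulVecLin (lapHW n)) z)
        = (3 ^ (n - 1 - j) - 1) / 2) ∧
    (∀ j, j + 2 ≤ n → Nat.card ((RH^[j]) ⁻¹' {(-5/3 : ℝ)} : Set ℝ) = 2 ^ j) := by
  refine ⟨?_, Hanoi.finrank_eigenspace_zero n, ?_, ?_, ?_, ?_⟩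
  · ext z
    simp only [Set.mem_ofPred_eq, Set.mem_union, Set.mem_singleton_iff, Set.mem_iUnion,
      Set.mem_preimage, exists_prop, or_assoc]
    exact Hanoi.hasEigenvalue_lap_iff_iterate
  · intro i hi z hz
    obtain ⟨m, rfl⟩ := Nat.exists_eq_add_of_lt hi
    rw [show i + m + 1 = m + 1 + i by omega, show m + 1 + i - 1 - i = m by omega]
    exact (Hanoi.finrank_eigenspace_of_iterate (Or.inl rfl) hz).trans
      (Hanoi.finrank_eigenspace_neg_one m)
  · intro i _
    exact (Hanoi.ncard_iterate_preimage_RH (by norm_num) i).1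
  · intro j hj z hz
    obtain ⟨m, rfl⟩ := Nat.exists_eq_add_of_le hj
    rw [show j + 2 + m = m + 1 + 1 + j by omega, show m + 1 + 1 + j - 1 - j = m + 1 by omega]
    exact (Hanoi.finrank_eigenspace_of_iterate (Or.inr rfl) hz).trans
      (Hanoi.finrank_eigenspace_neg_five_thirds (m + 1))
  · intro j _
    exact (Hanoi.ncard_iterate_preimage_RH (by norm_num) j).1
end
end

section
/- For n ≥ 1 the value −1 is an eigenvalue of the Hanoi graph Laplacian Δ^H_n with multiplicity (3^{n−1}+3)/2. -/
noncomputable section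
attribute [local instance] Classical.propDecidable

theorem finrank_involution_invariants {V : Type*} [Fintype V] (M : V → V)
    (hM : Function.Involutive M) :
    2 * Module.finrank ℝ (LinearMap.ker (LinearMap.funLeft ℝ ℝ M - LinearMap.id)) =
      Fintype.card V + Nat.card {v // M v = v} := by
  classical
  set E := LinearMap.ker (LinearMap.funLeft ℝ ℝ M - LinearMap.id) with hE
  have hmem : ∀ f : V → ℝ, f ∈ E ↔ ∀ v, f (M v) = f v := fun f => by
    simp [hE, LinearMap.mem_ker, sub_eq_zero, funext_iff, LinearMap.funLeft_apply]
  have hproj : LinearMap.IsProj E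
      ((2 : ℝ)⁻¹ • (LinearMap.id + LinearMap.funLeft ℝ ℝ M)) := by
    constructor
    · intro f
      rw [hmem]
      intro v
      simp [LinearMap.funLeft_apply, hM v, add_comm]
    · intro f hf
      rw [hmem] at hf
      ext v
      simp [LinearMap.funLeft_apply, hf v]
      ring
  have htr : LinearMap.trace ℝ (V → ℝ) (LinearMap.funLeft ℝ ℝ M) =
      Nat.card {v // M v = v} := by
    rw [LinearMap.trace_eq_matrix_trace ℝ (Pi.basisFun ℝ V), Matrix.trace,
      Nat.card_eq_fintype_card, Fintype.card_subtype]
    simp [LinearMap.funLeft_apply, Pi.single_apply]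
  have h := hproj.trace
  rw [map_smul, map_add, htr, LinearMap.trace_id, Module.finrank_fintype_fun_eq_card] at h
  simp only [smul_eq_mul] at h
  have h' : (2 * Module.finrank ℝ E : ℝ) = Fintype.card V + Nat.card {v // M v = v} := by
    rw [← h]; ring
  exact_mod_cast h'

/-- Summation over the fibres of `π`. -/
def fiberSum {V U : Type*} [Fintype V] (π : V → U) : (V → ℝ) →ₗ[ℝ] (U → ℝ) where
  toFun f u := ∑ v, if π v = u then f v else 0
  map_add' f g := by
    ext u
    simp only [Pi.add_apply, ← Finset.sum_add_distrib]
    exact Finset.sum_congr rfl fun v _ => by split_ifs <;> simp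
  map_smul' c f := by
    ext u
    simp [Finset.mul_sum]

theorem fiberSum_apply {V U : Type*} [Fintype V] (π : V → U) (f : V → ℝ) (u : U) :
    fiberSum π f u = ∑ v, if π v = u then f v else 0 := rfl

theorem sum_mul_fiberSum {V U : Type*} [Fintype V] [Fintype U] (π : V → U) (f : V → ℝ)
    (g : U → ℝ) : ∑ u, g u * fiberSum π f u = ∑ v, g (π v) * f v := by
  simp only [fiberSum_apply, Finset.mul_sum]
  rw [Finset.sum_comm]
  simp

/-- The involution-invariant functions with vanishing fibre sums form a space of the expected
dimension as soon as no nonzero function changes sign along the involution. -/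
theorem finrank_invariants_inf_ker_fiberSum {V U : Type*} [Fintype V] [Fintype U] (π : V → U)
    (M : V → V) (hM : Function.Involutive M)
    (key : ∀ g : U → ℝ, (∀ v, g (π v) = -g (π (M v))) → g = 0) :
    2 * (Module.finrank ℝ
        ↥(LinearMap.ker (LinearMap.funLeft ℝ ℝ M - LinearMap.id) ⊓ LinearMap.ker (fiberSum π)) +
      Fintype.card U) = Fintype.card V + Nat.card {v // M v = v} := by
  rw [← finrank_involution_invariants M hM]
  set E := LinearMap.ker (LinearMap.funLeft ℝ ℝ M - LinearMap.id) with hE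
  have hmem : ∀ f : V → ℝ, f ∈ E ↔ ∀ v, f (M v) = f v := fun f => by
    simp [hE, LinearMap.mem_ker, sub_eq_zero, funext_iff, LinearMap.funLeft_apply]
  let T : (U → ℝ) →ₗ[ℝ] E :=
    LinearMap.codRestrict E (LinearMap.funLeft ℝ ℝ π + LinearMap.funLeft ℝ ℝ (π ∘ M)) (by
      intro g
      rw [hmem]
      intro v
      simp [LinearMap.funLeft_apply, hM v, add_comm])
  have hT : ∀ g v, (T g : V → ℝ) v = g (π v) + g (π (M v)) := fun _ _ => rfl
  have hinj : Function.Injective ((fiberSum π).domRestrict E ∘ₗ T) := by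
    rw [← LinearMap.ker_eq_bot, LinearMap.ker_eq_bot']
    intro g hg
    apply key
    have h0 : ∑ v, g (π v) * (g (π v) + g (π (M v))) = 0 := by
      have h := sum_mul_fiberSum π (T g : V → ℝ) g
      have hz : fiberSum π (T g : V → ℝ) = 0 := hg
      rw [hz] at h
      simpa [hT] using h.symm
    have h1 : ∑ v, g (π (M v)) * (g (π (M v)) + g (π v)) = 0 := by
      rw [← h0, ← Equiv.sum_comp hM.toPerm]
      simp [hM _]
    have h2 : ∑ v, (g (π v) + g (π (M v))) ^ 2 = 0 := by
      rw [← add_zero (0 : ℝ)]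
      nth_rewrite 1 [← h0]
      rw [← h1, ← Finset.sum_add_distrib]
      exact Finset.sum_congr rfl fun v _ => by ring
    rw [Finset.sum_eq_zero_iff_of_nonneg fun _ _ => sq_nonneg _] at h2
    intro v
    exact eq_neg_of_add_eq_zero_left (pow_eq_zero_iff two_ne_zero |>.1 (h2 v (Finset.mem_univ v)))
  have hsurj : Function.Surjective ((fiberSum π).domRestrict E) := by
    have h := LinearMap.surjective_of_injective hinj
    rw [LinearMap.coe_comp] at h
    exact h.of_comp
  have hrn := LinearMap.finrank_range_add_finrank_ker ((fiberSum π).domRestrict E)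
  rw [LinearMap.range_eq_top.2 hsurj, finrank_top, Module.finrank_fintype_fun_eq_card] at hrn
  have hker : Module.finrank ℝ (LinearMap.ker ((fiberSum π).domRestrict E)) =
      Module.finrank ℝ ↥(E ⊓ LinearMap.ker (fiberSum π)) := by
    rw [← Submodule.map_comap_subtype, LinearMap.ker_domRestrict]
    exact (LinearEquiv.finrank_eq (Submodule.equivMapOfInjective _ E.injective_subtype _))
  omega

theorem adjHW_symm {n : ℕ} {w w' : Fin n → Fin 3} (h : adjHW w w') : adjHW w' w := by
  obtain ⟨k, h1, h2, h3, h4⟩ := h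
  exact ⟨k, h1.symm, fun m hm => (h2 m hm).symm, h4, h3⟩

/-- Adjacent words lying in different triangles. -/
def crossHW {m : ℕ} (w w' : Fin (m + 1) → Fin 3) : Prop :=
  adjHW w w' ∧ Fin.init w ≠ Fin.init w'

theorem crossHW_symm {m : ℕ} {w w' : Fin (m + 1) → Fin 3} (h : crossHW w w') : crossHW w' w :=
  ⟨adjHW_symm h.1, h.2.symm⟩

theorem crossHW_iff {m : ℕ} {w w' : Fin (m + 1) → Fin 3} :
    crossHW w w' ↔ ∃ k < Fin.last m, w k ≠ w (Fin.last m) ∧ (∀ i < k, w i = w' i) ∧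
      w' k = w (Fin.last m) ∧ (∀ i, k < i → w i = w (Fin.last m)) ∧ ∀ i, k < i → w' i = w k := by
  constructor
  · rintro ⟨⟨k, h1, h2, h3, h4⟩, hne⟩
    have hk : k < Fin.last m := by
      refine lt_of_le_of_ne (Fin.le_last k) ?_
      rintro rfl
      exact hne (funext fun i => h2 _ (Fin.castSucc_lt_last i))
    have hl := h3 _ hk
    exact ⟨k, hk, hl ▸ h1, h2, hl.symm, fun i hi => hl ▸ h3 i hi, h4⟩
  · rintro ⟨k, hk, h1, h2, h3, h4, h5⟩
    refine ⟨⟨k, h3 ▸ h1, h2, h3 ▸ h4, h5⟩, fun h => h1 ?_⟩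
    have := congrFun h (k.castPred hk.ne)
    simp only [Fin.init, Fin.castSucc_castPred] at this
    rw [this, h3]

theorem crossHW_unique {m : ℕ} {w a b : Fin (m + 1) → Fin 3} (ha : crossHW w a)
    (hb : crossHW w b) : a = b := by
  obtain ⟨k, -, h1, h2, h3, h4, h5⟩ := crossHW_iff.1 ha
  obtain ⟨l, -, g1, g2, g3, g4, g5⟩ := crossHW_iff.1 hb
  obtain h | rfl | h := lt_trichotomy k l
  · exact absurd (h4 l h) g1
  · ext1 i
    obtain h | rfl | h := lt_trichotomy i k
    · rw [← h2 i h, g2 i h]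
    · rw [h3, g3]
    · rw [h5 i h, g5 i h]
  · exact absurd (g4 k h) h1

theorem exists_crossHW_iff {m : ℕ} {w : Fin (m + 1) → Fin 3} :
    (∃ w', crossHW w w') ↔ ¬ ∃ j, w = fun _ => j := by
  constructor
  · rintro ⟨w', h⟩ ⟨j, rfl⟩
    obtain ⟨k, -, h1, -⟩ := crossHW_iff.1 h
    exact h1 rfl
  · intro h
    have hne : (Finset.univ.filter fun k => w k ≠ w (Fin.last m)).Nonempty := by
      by_contra hcon
      refine h ⟨w (Fin.last m), funext fun k => ?_⟩
      by_contra hk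
      exact hcon ⟨k, by simpa using hk⟩
    obtain ⟨k, hk, hmax⟩ := Finset.exists_max_image _ id hne
    simp only [Finset.mem_filter, Finset.mem_univ, true_and, id] at hk hmax
    refine ⟨fun i => if i < k then w i else if i = k then w (Fin.last m) else w k,
      crossHW_iff.2 ⟨k, lt_of_le_of_ne (Fin.le_last k) fun e => hk (by rw [e]), hk,
        fun i hi => by simp [hi], by simp, fun i hi => ?_, fun i hi => ?_⟩⟩
    · by_contra hi'
      exact absurd (hmax i hi') (not_le.2 hi)
    · simp [hi.not_gt, hi.ne']

/-- The involution exchanging the endpoints of the edges between triangles. -/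
def crossInv {m : ℕ} (w : Fin (m + 1) → Fin 3) : Fin (m + 1) → Fin 3 :=
  if h : ∃ w', crossHW w w' then h.choose else w

theorem crossInv_eq {m : ℕ} {w w' : Fin (m + 1) → Fin 3} (h : crossHW w w') :
    crossInv w = w' := by
  have he : ∃ w', crossHW w w' := ⟨w', h⟩
  rw [crossInv, dif_pos he]
  exact crossHW_unique he.choose_spec h

theorem crossInv_eq_self {m : ℕ} {w : Fin (m + 1) → Fin 3} (h : ¬ ∃ w', crossHW w w') :
    crossInv w = w := dif_neg h

theorem crossInv_involutive {m : ℕ} : Function.Involutive (crossInv (m := m)) := by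
  intro w
  by_cases h : ∃ w', crossHW w w'
  · obtain ⟨w', h⟩ := h
    rw [crossInv_eq h, crossInv_eq (crossHW_symm h)]
  · rw [crossInv_eq_self h, crossInv_eq_self h]

theorem crossInv_eq_self_iff {m : ℕ} {w : Fin (m + 1) → Fin 3} :
    crossInv w = w ↔ ∃ j, w = fun _ => j := by
  rw [← not_iff_not, ← exists_crossHW_iff]
  refine ⟨fun h => by_contra fun h' => h (crossInv_eq_self h'), ?_⟩
  rintro ⟨w', h⟩ e
  rw [crossInv_eq h] at e
  exact h.2 (by rw [e])

theorem card_fixed_crossInv (m : ℕ) :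
    Nat.card {w : Fin (m + 1) → Fin 3 // crossInv w = w} = 3 := by
  have e : Fin 3 ≃ {w : Fin (m + 1) → Fin 3 // crossInv w = w} :=
    Equiv.ofBijective (fun j => ⟨fun _ => j, crossInv_eq_self_iff.2 ⟨j, rfl⟩⟩)
      ⟨fun i j h => congrFun (congrArg Subtype.val h) 0, fun ⟨w, hw⟩ => by
        obtain ⟨j, rfl⟩ := crossInv_eq_self_iff.1 hw
        exact ⟨j, rfl⟩⟩
  rw [← Nat.card_congr e, Nat.card_fin]

/-- A function changing sign along edges and vanishing on constant words is zero. -/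
theorem eq_zero_of_adjHW_neg {m : ℕ} (g : (Fin m → Fin 3) → ℝ)
    (hadj : ∀ u u', adjHW u u' → g u = -g u') (hconst : ∀ j, g (fun _ => j) = 0) : g = 0 := by
  have main : ∀ d k : ℕ, k + d = m → ∀ (u : Fin m → Fin 3) (j : Fin 3),
      g (fun i => if k ≤ i.val then j else u i) = 0 → g u = 0 := by
    intro d
    induction d with
    | zero =>
      intro k hk u j h
      convert h using 2
      ext1 i
      rw [if_neg (by omega)]
    | succ d ih =>
      intro k hk u j h
      have hkm : k < m := by omega
      by_cases hj : u ⟨k, hkm⟩ = j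
      · refine ih (k + 1) (by omega) u j ?_
        convert h using 2
        ext1 i
        by_cases hi : i = ⟨k, hkm⟩
        · subst hi; simp [hj]
        · have : i.val ≠ k := fun e => hi (Fin.ext e)
          have : k + 1 ≤ i.val ↔ k ≤ i.val := by omega
          simp [this]
      · refine ih (k + 1) (by omega) u j ?_
        rw [hadj _ (fun i => if k + 1 ≤ i.val then u ⟨k, hkm⟩ else if i.val = k then j else u i)
          ⟨⟨k, hkm⟩, ?_, ?_, ?_, ?_⟩, neg_eq_zero]
        · refine ih (k + 1) (by omega) _ j ?_
          convert h using 2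
          ext1 i
          by_cases h1 : k + 1 ≤ i.val
          · simp [h1, show k ≤ i.val by omega]
          · by_cases h2 : i.val = k
            · simp [h2]
            · simp [h1, h2, show ¬ k ≤ i.val by omega]
        · simpa using hj
        · intro i hi
          have : i.val < k := hi
          simp [show ¬ k + 1 ≤ i.val by omega, show i.val ≠ k by omega]
        · intro i hi
          have : k < i.val := hi
          simp [show k + 1 ≤ i.val by omega]
        · intro i hi
          have : k < i.val := hi
          simp [show k + 1 ≤ i.val by omega]
  ext1 u
  exact main m 0 (by omega) u 0 (by simpa using hconst 0)

theorem crossHW_snoc {m : ℕ} {u u' : Fin m → Fin 3} (h : adjHW u u') :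
    ∃ v v' : Fin (m + 1) → Fin 3, crossHW v v' ∧ Fin.init v = u ∧ Fin.init v' = u' := by
  obtain ⟨k, h1, h2, h3, h4⟩ := h
  refine ⟨Fin.snoc (α := fun _ => Fin 3) u (u' k), Fin.snoc (α := fun _ => Fin 3) u' (u k),
    ⟨⟨k.castSucc, by simpa using h1, ?_, ?_, ?_⟩, ?_⟩, Fin.init_snoc _ _, Fin.init_snoc _ _⟩
  · intro i hi
    induction i using Fin.lastCases with
    | last => exact absurd hi (Fin.castSucc_lt_last k).not_gt
    | cast i => simpa using h2 i (by simpa using hi)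
  · intro i hi
    induction i using Fin.lastCases with
    | last => simp
    | cast i => simpa using h3 i (by simpa using hi)
  · intro i hi
    induction i using Fin.lastCases with
    | last => simp
    | cast i => simpa using h4 i (by simpa using hi)
  · simp only [Fin.init_snoc]
    rintro rfl
    exact h1 rfl

theorem eq_zero_of_crossInv_neg {m : ℕ} (g : (Fin m → Fin 3) → ℝ)
    (h : ∀ v : Fin (m + 1) → Fin 3, g (Fin.init v) = -g (Fin.init (crossInv v))) : g = 0 := by
  refine eq_zero_of_adjHW_neg g (fun u u' hu => ?_) fun j => ?_
  · obtain ⟨v, v', hv, rfl, rfl⟩ := crossHW_snoc hu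
    rw [h v, crossInv_eq hv]
  · have hj := h fun _ => j
    rw [crossInv_eq_self_iff.2 ⟨j, rfl⟩] at hj
    have : g (fun _ => j) = -g (fun _ => j) := hj
    linarith

theorem adjHW_of_init_eq {m : ℕ} {w w' : Fin (m + 1) → Fin 3} (h : Fin.init w = Fin.init w')
    (hne : w ≠ w') : adjHW w w' := by
  have hlt : ∀ i, i < Fin.last m → w i = w' i := fun i hi => by
    have := congrFun h (i.castPred hi.ne)
    simpa [Fin.init] using this
  refine ⟨Fin.last m, fun e => hne (funext fun i => ?_), hlt, fun i hi => ?_, fun i hi => ?_⟩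
  · obtain h | h := (Fin.le_last i).lt_or_eq
    · exact hlt i h
    · rw [h, e]
  · exact absurd hi (Fin.le_last i).not_gt
  · exact absurd hi (Fin.le_last i).not_gt

theorem fiberSum_init_const {m : ℕ} (c : ℝ) (u : Fin m → Fin 3) :
    fiberSum (fun w : Fin (m + 1) → Fin 3 => (Fin.init w : Fin m → Fin 3)) (fun _ => c) u
      = 3 * c := by
  rw [fiberSum_apply, ← Equiv.sum_comp (Fin.snocEquiv fun _ => Fin 3), Fintype.sum_prod_type]
  simp [Fin.snocEquiv]

theorem lapHW_mulVec {m : ℕ} (f : (Fin (m + 1) → Fin 3) → ℝ) (w : Fin (m + 1) → Fin 3) :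
    (lapHW (m + 1)).mulVec f w = 3⁻¹ * (fiberSum
      (fun w : Fin (m + 1) → Fin 3 => (Fin.init w : Fin m → Fin 3)) f (Fin.init w)
        - 4 * f w + f (crossInv w)) := by
  have h1 : (lapHW (m + 1)).mulVec f w =
      3⁻¹ * ∑ w', if adjHW w w' then f w' - f w else 0 := by
    simp only [Matrix.mulVec, dotProduct, lapHW, Matrix.of_apply, mul_assoc, ← Finset.mul_sum]
    congr 1
    simp only [sub_mul, Finset.sum_sub_distrib, ite_mul, zero_mul, one_mul]
    rw [Finset.sum_ite_eq' Finset.univ w, if_pos (Finset.mem_univ _), Finset.sum_mul,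
      ← Finset.sum_sub_distrib]
    exact Finset.sum_congr rfl fun w' _ => by split_ifs <;> simp
  have h2 : ∀ w', (if adjHW w w' then f w' - f w else 0) =
      (if Fin.init w' = Fin.init w then (f w' - f w) else 0) +
      (if w' = crossInv w then f w' - f w else 0) := by
    intro w'
    by_cases hc : crossHW w w'
    · rw [if_pos hc.1, if_neg hc.2.symm, if_pos (crossInv_eq hc).symm, zero_add]
    · have hz : (if w' = crossInv w then f w' - f w else 0) = 0 := by
        split_ifs with e
        · by_cases he : ∃ w', crossHW w w'
          · obtain ⟨v, hv⟩ := he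
            rw [crossInv_eq hv] at e
            exact absurd (e ▸ hv) hc
          · rw [e, crossInv_eq_self he, sub_self]
        · rfl
      rw [hz, add_zero]
      by_cases hi : Fin.init w' = Fin.init w
      · rw [if_pos hi]
        split_ifs with ha
        · rfl
        · have : w = w' := by_contra fun hne => ha (adjHW_of_init_eq hi.symm hne)
          rw [this, sub_self]
      · rw [if_neg hi, if_neg fun ha => hc ⟨ha, Ne.symm hi⟩]
  have h3 : ∑ w', (if Fin.init w' = Fin.init w then (f w' - f w) else 0) = fiberSum
      (fun w : Fin (m + 1) → Fin 3 => (Fin.init w : Fin m → Fin 3)) f (Fin.init w) - 3 * f w := by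
    rw [← fiberSum_init_const (f w) (Fin.init w), ← Pi.sub_apply, ← map_sub, fiberSum_apply]
    exact Finset.sum_congr rfl fun v _ => by simp only [Pi.sub_apply]
  rw [h1, Finset.sum_congr rfl fun w' _ => h2 w', Finset.sum_add_distrib, h3,
    Finset.sum_ite_eq' Finset.univ (crossInv w), if_pos (Finset.mem_univ _)]
  ring

theorem eigenspace_lapHW (m : ℕ) :
    Module.End.eigenspace (Matrix.mulVecLin (lapHW (m + 1))) (-1) =
      LinearMap.ker (LinearMap.funLeft ℝ ℝ (crossInv (m := m)) - LinearMap.id) ⊓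
      LinearMap.ker
        (fiberSum fun w : Fin (m + 1) → Fin 3 => (Fin.init w : Fin m → Fin 3)) := by
  ext f
  set s := fiberSum (fun w : Fin (m + 1) → Fin 3 => (Fin.init w : Fin m → Fin 3)) f with hs
  rw [Module.End.mem_eigenspace_iff, Submodule.mem_inf, LinearMap.mem_ker, LinearMap.mem_ker,
    ← hs, LinearMap.sub_apply, sub_eq_zero, funext_iff, funext_iff]
  simp only [Matrix.mulVecLin_apply, lapHW_mulVec, ← hs, Pi.smul_apply, smul_eq_mul,
    LinearMap.funLeft_apply, LinearMap.id_apply]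
  constructor
  · intro h
    have h0 : s = 0 := eq_zero_of_crossInv_neg s fun v => by
      have h1 := h v
      have h2 := h (crossInv v)
      rw [crossInv_involutive v] at h2
      linarith
    refine ⟨fun v => ?_, h0⟩
    have h1 := h v
    rw [h0, Pi.zero_apply] at h1
    linarith
  · rintro ⟨h1, h2⟩ v
    rw [h1 v, h2, Pi.zero_apply]
    ring

/-- For `n ≥ 1`, `-1` is an eigenvalue of `Δ^H_n` with multiplicity `(3^{n-1}+3)/2`. -/
theorem H_eigenvalue_neg_one (n : ℕ) (hn : 1 ≤ n) :
    Module.End.HasEigenvalue (Matrix.mulVecLin (lapHW n)) (-1) ∧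
    Module.finrank ℝ (Module.End.eigenspace (Matrix.mulVecLin (lapHW n)) (-1))
      = (3 ^ (n - 1) + 3) / 2 := by
  obtain ⟨m, rfl⟩ : ∃ m, n = m + 1 := ⟨n - 1, by omega⟩
  have hdim := finrank_invariants_inf_ker_fiberSum
    (fun w : Fin (m + 1) → Fin 3 => (Fin.init w : Fin m → Fin 3)) crossInv crossInv_involutive
    eq_zero_of_crossInv_neg
  rw [← eigenspace_lapHW, card_fixed_crossInv] at hdim
  simp only [Fintype.card_fun, Fintype.card_fin, pow_succ] at hdim
  have hpos : 1 ≤ 3 ^ m := Nat.one_le_pow _ _ (by norm_num)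
  refine ⟨Module.End.hasEigenvalue_iff.2 fun h => ?_, by rw [Nat.add_sub_cancel]; omega⟩
  rw [h, finrank_bot] at hdim
  omega
end
end

section
/- For n ≥ 0 the value −3/2 is an eigenvalue of the Sierpinski gasket graph Laplacian Δ^G_n, with eigenspace equal to the set of functions f satisfying Σ_{j=1}^3 f(F_w(p_j)) = 0 for every word w of length n, which has dimension (3^n+3)/2. -/
noncomputable section
attribute [local instance] Classical.propDecidable

abbrev Pt := ℝ × ℝ

def Fmap (p : Fin 3 → Pt) (j : Fin 3) (x : Pt) : Pt := midpoint ℝ x (p j)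

def cent (p : Fin 3 → Pt) : Pt := (3 : ℝ)⁻¹ • (p 0 + p 1 + p 2)

def Fw (p : Fin 3 → Pt) : List (Fin 3) → Pt → Pt
  | [] => id
  | j :: w => Fmap p j ∘ Fw p w

def VG (p : Fin 3 → Pt) (n : ℕ) : Set Pt :=
  {x | ∃ w : List (Fin 3), w.length = n ∧ ∃ j : Fin 3, x = Fw p w (p j)}

def VH (p : Fin 3 → Pt) (n : ℕ) : Set Pt :=
  {x | ∃ w : List (Fin 3), w.length = n ∧ x = Fw p w (cent p)}

def VJ (p : Fin 3 → Pt) (n : ℕ) : Set Pt := VG p n ∪ VH p n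

def adjG (p : Fin 3 → Pt) (n : ℕ) (x y : Pt) : Prop :=
  x ≠ y ∧ ∃ w : List (Fin 3), w.length = n ∧
    ∃ j k : Fin 3, x = Fw p w (p j) ∧ y = Fw p w (p k)

def adjJ (p : Fin 3 → Pt) (n : ℕ) (x y : Pt) : Prop :=
  ∃ w : List (Fin 3), w.length = n ∧ ∃ j : Fin 3,
    ((x = Fw p w (cent p) ∧ y = Fw p w (p j)) ∨
     (y = Fw p w (cent p) ∧ x = Fw p w (p j)))

def adjH (p : Fin 3 → Pt) (n : ℕ) (x y : Pt) : Prop :=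
  x ≠ y ∧ x ∈ VH p n ∧ y ∈ VH p n ∧ ∃ z : Pt, adjJ p n x z ∧ adjJ p n y z

/-- Graph Laplacian of the Sierpinski gasket graph `G_n`
(degree 2 at the three corners, 4 elsewhere). -/
def lapG (p : Fin 3 → Pt) (n : ℕ) (f : Pt → ℝ) (x : Pt) : ℝ :=
  (if x ∈ Set.range p then (2:ℝ) else 4)⁻¹ * ∑ᶠ y ∈ {y | adjG p n x y}, (f y - f x)

/-- Graph Laplacian of the subdivision graph `J_n`
(degree 1 at the three corners, 3 at the centers `V^H_n`, 2 elsewhere). -/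
def lapJ (p : Fin 3 → Pt) (n : ℕ) (f : Pt → ℝ) (x : Pt) : ℝ :=
  (if x ∈ Set.range p then (1:ℝ) else if x ∈ VH p n then 3 else 2)⁻¹ *
    ∑ᶠ y ∈ {y | adjJ p n x y}, (f y - f x)

/-- Graph Laplacian of the Hanoi graph `H_n`; it is 3-regular with loops at the
three corners, and a loop contributes `f x - f x = 0` to the sum. -/
def lapH (p : Fin 3 → Pt) (n : ℕ) (f : Pt → ℝ) (x : Pt) : ℝ :=
  (3:ℝ)⁻¹ * ∑ᶠ y ∈ {y | adjH p n x y}, (f y - f x)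

section

variable {p : Fin 3 → Pt}

lemma Fw_cons (a : Fin 3) (w : List (Fin 3)) (x : Pt) :
    Fw p (a :: w) x = Fmap p a (Fw p w x) := rfl

lemma Fmap_self (a : Fin 3) : Fmap p a (p a) = p a := midpoint_self _ _

lemma Fmap_comm (a b : Fin 3) : Fmap p a (p b) = Fmap p b (p a) := midpoint_comm _ _

lemma Fmap_injective (a : Fin 3) : Function.Injective (Fmap p a) := by
  intro x y h
  have h' := congrArg (fun z => z + z) h
  simpa only [Fmap, midpoint_add_self, add_left_inj] using h'

lemma Fw_injective (w : List (Fin 3)) : Function.Injective (Fw p w) := by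
  induction w with
  | nil => exact Function.injective_id
  | cons a w ih => exact (Fmap_injective a).comp ih

lemma Fw_replicate (n : ℕ) (a : Fin 3) : Fw p (List.replicate n a) (p a) = p a := by
  induction n with
  | zero => rfl
  | succ n ih => rw [List.replicate_succ, Fw_cons, ih, Fmap_self]

/-- The three vertices, as an affine basis of the plane. -/
def vertexBasis (hp : AffineIndependent ℝ p) : AffineBasis (Fin 3) ℝ Pt :=
  ⟨p, hp, by
    rw [hp.affineSpan_eq_top_iff_card_eq_finrank_add_one]
    simp⟩

lemma coord_vertex (hp : AffineIndependent ℝ p) (i j : Fin 3) :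
    (vertexBasis hp).coord i (p j) = if i = j then 1 else 0 :=
  (vertexBasis hp).coord_apply i j

lemma coord_Fmap (hp : AffineIndependent ℝ p) (i a : Fin 3) (x : Pt) :
    (vertexBasis hp).coord i (Fmap p a x) =
      ((vertexBasis hp).coord i x + if i = a then 1 else 0) / 2 := by
  rw [← coord_vertex hp, Fmap, AffineMap.map_midpoint, midpoint_eq_smul_add, smul_eq_mul]
  simp
  ring

lemma coord_Fw_nonneg (hp : AffineIndependent ℝ p) (w : List (Fin 3)) (i j : Fin 3) :
    0 ≤ (vertexBasis hp).coord i (Fw p w (p j)) := by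
  induction w with
  | nil =>
    change 0 ≤ (vertexBasis hp).coord i (p j)
    rw [coord_vertex]
    split_ifs <;> norm_num
  | cons a w ih =>
    rw [Fw_cons, coord_Fmap]
    split_ifs <;> linarith

lemma eq_vertex_of_one_le_coord (hp : AffineIndependent ℝ p)
    {x : Pt} (hx : ∀ i, 0 ≤ (vertexBasis hp).coord i x)
    {b : Fin 3} (hb : 1 ≤ (vertexBasis hp).coord b x) : x = p b := by
  have hs := (vertexBasis hp).sum_coord_apply_eq_one x
  rw [← Finset.add_sum_erase _ _ (Finset.mem_univ b)] at hs
  have hz : ∀ i ∈ Finset.univ.erase b, (vertexBasis hp).coord i x = 0 := by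
    rw [← Finset.sum_eq_zero_iff_of_nonneg fun i _ => hx i]
    exact le_antisymm (by linarith) (Finset.sum_nonneg fun i _ => hx i)
  rw [Finset.sum_eq_zero hz] at hs
  refine (vertexBasis hp).ext_elem fun i => ?_
  rw [coord_vertex]
  split_ifs with h
  · subst h; linarith
  · exact hz i (by simp [h])

lemma coord_Fw_le_one (hp : AffineIndependent ℝ p) (w : List (Fin 3)) (i j : Fin 3) :
    (vertexBasis hp).coord i (Fw p w (p j)) ≤ 1 := by
  rw [← (vertexBasis hp).sum_coord_apply_eq_one (Fw p w (p j))]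
  exact Finset.single_le_sum (f := fun i => (vertexBasis hp).coord i (Fw p w (p j)))
    (fun i _ => coord_Fw_nonneg hp w i j) (Finset.mem_univ i)

lemma Fw_eq_vertex_iff (hp : AffineIndependent ℝ p) (w : List (Fin 3)) (j b : Fin 3) :
    Fw p w (p j) = p b ↔ w = List.replicate w.length b ∧ j = b := by
  refine ⟨fun h => ?_, fun ⟨hw, hj⟩ => by rw [hw, hj, Fw_replicate]⟩
  induction w with
  | nil => exact ⟨rfl, hp.injective h⟩
  | cons a w ih =>
    have hc := congrArg ((vertexBasis hp).coord b) h
    rw [Fw_cons, coord_Fmap, coord_vertex, if_pos rfl] at hc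
    have hle := coord_Fw_le_one hp w b j
    split_ifs at hc with hba
    · subst hba
      obtain ⟨hw, hj⟩ := ih (eq_vertex_of_one_le_coord hp
        (fun i => coord_Fw_nonneg hp w i j) (by linarith))
      exact ⟨by rw [List.length_cons, List.replicate_succ, ← hw], hj⟩
    · linarith

lemma eq_vertices_of_Fmap_eq (hp : AffineIndependent ℝ p)
    {a b : Fin 3} (hab : a ≠ b) {u w : List (Fin 3)} {j k : Fin 3}
    (h : Fmap p a (Fw p u (p j)) = Fmap p b (Fw p w (p k))) :
    Fw p u (p j) = p b ∧ Fw p w (p k) = p a := by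
  have ha := congrArg ((vertexBasis hp).coord a) h
  have hb := congrArg ((vertexBasis hp).coord b) h
  simp only [coord_Fmap, hab, hab.symm, if_true, if_false] at ha hb
  have h1 := coord_Fw_nonneg hp u a j
  have h2 := coord_Fw_nonneg hp w b k
  exact ⟨eq_vertex_of_one_le_coord hp (fun i => coord_Fw_nonneg hp u i j) (by linarith),
    eq_vertex_of_one_le_coord hp (fun i => coord_Fw_nonneg hp w i k) (by linarith)⟩

/-- Two distinct cells of the same level share at most one vertex. -/
lemma shared_vertex_unique (hp : AffineIndependent ℝ p)
    {u w : List (Fin 3)} (hl : u.length = w.length) (hne : u ≠ w)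
    {i j k l : Fin 3} (h1 : Fw p u (p i) = Fw p w (p k)) (h2 : Fw p u (p j) = Fw p w (p l)) :
    i = j := by
  induction u generalizing w with
  | nil => exact absurd (List.length_eq_zero_iff.1 hl.symm).symm hne
  | cons a u ih =>
    obtain _ | ⟨b, w⟩ := w
    · simp at hl
    rw [Fw_cons, Fw_cons] at h1 h2
    by_cases hab : a = b
    · subst hab
      exact ih (by simpa using hl) (by simpa using hne) (Fmap_injective a h1)
        (Fmap_injective a h2)
    · have e1 := (eq_vertices_of_Fmap_eq hp hab h1).1
      have e2 := (eq_vertices_of_Fmap_eq hp hab h2).1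
      exact hp.injective (Fw_injective u (e1.trans e2.symm))

/-- A vertex of a cell other than the three corners is a vertex of exactly one further cell of
the same level. -/
lemma exists_second_address (hp : AffineIndependent ℝ p) {w : List (Fin 3)} {j : Fin 3}
    (hw : w ≠ List.replicate w.length j) :
    ∃ (w' : List (Fin 3)) (k : Fin 3), w'.length = w.length ∧ w' ≠ w ∧
      Fw p w' (p k) = Fw p w (p j) ∧
      ∀ (u : List (Fin 3)) (l : Fin 3), u.length = w.length → Fw p u (p l) = Fw p w (p j) →
        (u = w ∧ l = j) ∨ (u = w' ∧ l = k) := by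
  induction w with
  | nil => exact absurd rfl hw
  | cons a w ih =>
    by_cases hc : w = List.replicate w.length j
    · have haj : a ≠ j := by
        rintro rfl
        exact hw (by rw [List.length_cons, List.replicate_succ, ← hc])
      have hwj : Fw p w (p j) = p j := (Fw_eq_vertex_iff hp w j j).2 ⟨hc, rfl⟩
      refine ⟨j :: List.replicate w.length a, a, by simp, ?_, ?_, ?_⟩
      · exact fun h => haj (List.cons.inj h).1.symm
      · rw [Fw_cons, Fw_cons, Fw_replicate, hwj, Fmap_comm]
      · rintro (_ | ⟨b, u⟩) l hl h
        · simp at hl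
        replace hl : u.length = w.length := by simpa using hl
        rw [Fw_cons, Fw_cons] at h
        by_cases hba : b = a
        · subst hba
          have hu := Fmap_injective b h
          rw [hwj, Fw_eq_vertex_iff hp] at hu
          left
          refine ⟨?_, hu.2⟩
          rw [hu.1, hl, ← hc]
        · obtain ⟨e1, e2⟩ := eq_vertices_of_Fmap_eq hp hba h
          have hbj : b = j := hp.injective (e2.symm.trans hwj)
          rw [Fw_eq_vertex_iff hp, hl] at e1
          exact Or.inr ⟨by rw [← e1.1, hbj], e1.2⟩
    · obtain ⟨w', k, hl', hne, heq, huniq⟩ := ih hc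
      refine ⟨a :: w', k, by simp [hl'], by simpa using hne, by rw [Fw_cons, heq, Fw_cons], ?_⟩
      rintro (_ | ⟨b, u⟩) l hl h
      · simp at hl
      replace hl : u.length = w.length := by simpa using hl
      rw [Fw_cons, Fw_cons] at h
      by_cases hba : b = a
      · subst hba
        simpa using huniq u l hl (Fmap_injective b h)
      · obtain ⟨-, e2⟩ := eq_vertices_of_Fmap_eq hp hba h
        obtain ⟨e, rfl⟩ := (Fw_eq_vertex_iff hp _ _ _).1 e2
        exact absurd e hc

lemma Fw_mem_range_iff (hp : AffineIndependent ℝ p) (w : List (Fin 3)) (j : Fin 3) :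
    Fw p w (p j) ∈ Set.range p ↔ w = List.replicate w.length j := by
  constructor
  · rintro ⟨b, hb⟩
    obtain ⟨hw, rfl⟩ := (Fw_eq_vertex_iff hp w j b).1 hb.symm
    exact hw
  · intro h
    exact ⟨j, ((Fw_eq_vertex_iff hp w j j).2 ⟨h, rfl⟩).symm⟩

/-- A function on cells that changes sign across every shared vertex vanishes everywhere as soon
as it vanishes on one cell. -/
lemma eq_zero_of_alternating (n : ℕ) (y : List (Fin 3) → ℝ)
    (hy : ∀ u w : List (Fin 3), u.length = n → w.length = n → u ≠ w →
      (∃ j k, Fw p u (p j) = Fw p w (p k)) → y u + y w = 0)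
    {v : List (Fin 3)} (hv : v.length = n) (h0 : y v = 0) {w : List (Fin 3)}
    (hw : w.length = n) : y w = 0 := by
  induction n generalizing y v w with
  | zero =>
    rw [List.length_eq_zero_iff] at hv hw
    rwa [hw, ← hv]
  | succ n ih =>
    obtain _ | ⟨a, v⟩ := v
    · simp at hv
    obtain _ | ⟨b, w⟩ := w
    · simp at hw
    have hcell : ∀ (c : Fin 3) (v w : List (Fin 3)), v.length = n → w.length = n →
        y (c :: v) = 0 → y (c :: w) = 0 := by
      intro c v w hv hw h
      refine ih (fun u => y (c :: u)) ?_ hv h hw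
      rintro u u' hu hu' hne ⟨j, k, e⟩
      exact hy _ _ (by simp [hu]) (by simp [hu']) (by simpa using hne)
        ⟨j, k, by rw [Fw_cons, Fw_cons, e]⟩
    replace hv : v.length = n := by simpa using hv
    replace hw : w.length = n := by simpa using hw
    by_cases hab : a = b
    · subst hab
      exact hcell a v w hv hw h0
    · have h1 := hcell a v (List.replicate n b) hv (by simp) h0
      have h2 := hy (a :: List.replicate n b) (b :: List.replicate n a) (by simp) (by simp)
        (fun h => hab (List.cons.inj h).1)
        ⟨b, a, by rw [Fw_cons, Fw_cons, Fw_replicate, Fw_replicate, Fmap_comm]⟩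
      exact hcell b (List.replicate n a) w (by simp) hw (by linarith)

/-- The sum of `f` over the three vertices of the cell `w`. -/
def cellSum (p : Fin 3 → Pt) (f : Pt → ℝ) (w : List (Fin 3)) : ℝ := ∑ k, f (Fw p w (p k))

lemma finsum_mem_cell (hp : AffineIndependent ℝ p) (w : List (Fin 3)) (g : Pt → ℝ) :
    ∑ᶠ y ∈ Set.range (fun k => Fw p w (p k)), g y = cellSum p g w := by
  rw [finsum_mem_range (g := fun k => Fw p w (p k)) ((Fw_injective w).comp hp.injective),
    finsum_eq_sum_of_fintype]
  rfl

lemma cellSum_sub_const (f : Pt → ℝ) (c : ℝ) (w : List (Fin 3)) :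
    cellSum p (fun y => f y - c) w = cellSum p f w - 3 * c := by
  simp [cellSum, Finset.sum_sub_distrib]

lemma lapG_corner (hp : AffineIndependent ℝ p) (f : Pt → ℝ) {w : List (Fin 3)} {j : Fin 3}
    (hw : w = List.replicate w.length j) :
    lapG p w.length f (Fw p w (p j)) = 2⁻¹ * (cellSum p f w - 3 * f (Fw p w (p j))) := by
  have hcorner : Fw p w (p j) = p j := (Fw_eq_vertex_iff hp w j j).2 ⟨hw, rfl⟩
  have hset : insert (Fw p w (p j)) {y | adjG p w.length (Fw p w (p j)) y} =
      Set.range (fun k => Fw p w (p k)) := by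
    ext y
    simp only [Set.mem_insert_iff, Set.mem_ofPred_eq, Set.mem_range, adjG]
    constructor
    · rintro (rfl | ⟨-, u, hu, l, k, hx, rfl⟩)
      · exact ⟨j, rfl⟩
      · rw [hcorner, eq_comm, Fw_eq_vertex_iff hp, hu, ← hw] at hx
        exact ⟨k, by rw [hx.1]⟩
    · rintro ⟨k, rfl⟩
      by_cases h : Fw p w (p k) = Fw p w (p j)
      · exact Or.inl h
      · exact Or.inr ⟨fun e => h e.symm, w, rfl, j, k, rfl, rfl⟩
  rw [lapG, if_pos ((Fw_mem_range_iff hp w j).2 hw), ← cellSum_sub_const,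
    ← finsum_mem_cell hp, ← hset,
    finsum_mem_insert_zero (sub_self _)]

lemma lapG_interior (hp : AffineIndependent ℝ p) (f : Pt → ℝ) {w w' : List (Fin 3)} {j k : Fin 3}
    (hw : w ≠ List.replicate w.length j) (hl : w'.length = w.length) (hne : w' ≠ w)
    (heq : Fw p w' (p k) = Fw p w (p j))
    (huniq : ∀ (u : List (Fin 3)) (l : Fin 3), u.length = w.length →
      Fw p u (p l) = Fw p w (p j) → (u = w ∧ l = j) ∨ (u = w' ∧ l = k)) :
    lapG p w.length f (Fw p w (p j)) =
      4⁻¹ * (cellSum p f w + cellSum p f w' - 6 * f (Fw p w (p j))) := by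
  set x := Fw p w (p j) with hx
  have hset : insert x {y | adjG p w.length x y} =
      Set.range (fun k => Fw p w (p k)) ∪ Set.range (fun k => Fw p w' (p k)) := by
    ext y
    simp only [Set.mem_insert_iff, Set.mem_ofPred_eq, Set.mem_union, Set.mem_range, adjG]
    constructor
    · rintro (rfl | ⟨-, u, hu, l, m, hxu, rfl⟩)
      · exact Or.inl ⟨j, rfl⟩
      · rcases huniq u l hu hxu.symm with ⟨rfl, -⟩ | ⟨rfl, -⟩
        · exact Or.inl ⟨m, rfl⟩
        · exact Or.inr ⟨m, rfl⟩
    · rintro (⟨m, rfl⟩ | ⟨m, rfl⟩)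
      · by_cases h : Fw p w (p m) = x
        · exact Or.inl h
        · exact Or.inr ⟨fun e => h e.symm, w, rfl, j, m, hx, rfl⟩
      · by_cases h : Fw p w' (p m) = x
        · exact Or.inl h
        · exact Or.inr ⟨fun e => h e.symm, w', hl, k, m, heq.symm, rfl⟩
  have hinter : Set.range (fun k => Fw p w (p k)) ∩ Set.range (fun k => Fw p w' (p k)) = {x} := by
    ext y
    constructor
    · rintro ⟨⟨m, rfl⟩, ⟨l, hml⟩⟩
      have := shared_vertex_unique hp hl.symm hne.symm hml.symm heq.symm
      rw [this]
      rfl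
    · rintro rfl
      exact ⟨⟨j, rfl⟩, ⟨k, heq⟩⟩
  have hsum := finsum_mem_union_inter (f := fun y => f y - f x)
    (Set.finite_range (fun k => Fw p w (p k))) (Set.finite_range (fun k => Fw p w' (p k)))
  rw [hinter, ← hset, finsum_mem_singleton, finsum_mem_insert_zero (sub_self _),
    finsum_mem_cell hp, finsum_mem_cell hp, cellSum_sub_const, cellSum_sub_const] at hsum
  rw [lapG, if_neg (fun h => hw ((Fw_mem_range_iff hp w j).1 h))]
  linarith

lemma eigen_iff_cellSum (hp : AffineIndependent ℝ p) (n : ℕ) (f : Pt → ℝ) :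
    (∀ x ∈ VG p n, lapG p n f x = (-3/2 : ℝ) * f x) ↔
      ∀ w : List (Fin 3), w.length = n → cellSum p f w = 0 := by
  constructor
  · intro h w hw
    refine eq_zero_of_alternating (p := p) n (cellSum p f) ?_ (v := List.replicate n 0) (by simp)
      ?_ hw
    · rintro u u' hu hu' hne ⟨j, k, e⟩
      have hc : u ≠ List.replicate u.length j := by
        intro hc
        have hx := (Fw_eq_vertex_iff hp u j j).2 ⟨hc, rfl⟩
        rw [e, Fw_eq_vertex_iff hp, hu', ← hu, ← hc] at hx
        exact hne hx.1.symm
      obtain ⟨w', l, hl, hne', heq, huniq⟩ := exists_second_address hp hc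
      obtain ⟨rfl, rfl⟩ : u' = w' ∧ k = l :=
        (huniq u' k (hu'.trans hu.symm) e.symm).resolve_left fun h => hne h.1.symm
      have := h _ ⟨u, hu, j, rfl⟩
      subst hu
      rw [lapG_interior hp f hc hl hne' heq huniq] at this
      linarith
    · have := h _ ⟨List.replicate n 0, by simp, 0, rfl⟩
      have h2 := lapG_corner hp f (w := List.replicate n 0) (j := 0) (by simp)
      rw [List.length_replicate, this] at h2
      linarith
  · rintro h _ ⟨w, rfl, j, rfl⟩
    by_cases hc : w = List.replicate w.length j
    · rw [lapG_corner hp f hc, h w rfl]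
      ring
    · obtain ⟨w', l, hl, hne', heq, huniq⟩ := exists_second_address hp hc
      rw [lapG_interior hp f hc hl hne' heq huniq, h w rfl, h w' hl]
      ring

/-- The vertex with address `a`. -/
def addressPoint (p : Fin 3 → Pt) (n : ℕ) (a : List.Vector (Fin 3) n × Fin 3) : Pt :=
  Fw p a.1.toList (p a.2)

/-- The vertices of `G_n`, as a finset. -/
def vertexFinset (p : Fin 3 → Pt) (n : ℕ) : Finset Pt := Finset.univ.image (addressPoint p n)

lemma mem_vertexFinset {n : ℕ} {x : Pt} : x ∈ vertexFinset p n ↔ x ∈ VG p n := by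
  simp only [vertexFinset, Finset.mem_image, Finset.mem_univ, true_and]
  constructor
  · rintro ⟨⟨w, j⟩, rfl⟩
    exact ⟨w.toList, w.2, j, rfl⟩
  · rintro ⟨w, hw, j, rfl⟩
    exact ⟨(⟨w, hw⟩, j), rfl⟩

lemma fiber_corner (hp : AffineIndependent ℝ p) {n : ℕ} (w : List.Vector (Fin 3) n) (j : Fin 3)
    (hw : w.toList = List.replicate w.toList.length j) :
    Finset.univ.filter (fun a => addressPoint p n a = Fw p w.toList (p j)) = {(w, j)} := by
  ext ⟨u, l⟩
  have hwj : Fw p w.toList (p j) = p j := (Fw_eq_vertex_iff hp _ j j).2 ⟨hw, rfl⟩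
  simp only [Finset.mem_filter, Finset.mem_univ, true_and, Finset.mem_singleton]
  constructor
  · intro h
    rw [addressPoint, hwj, Fw_eq_vertex_iff hp, List.Vector.toList_length] at h
    rw [List.Vector.toList_length] at hw
    exact Prod.ext (List.Vector.eq _ _ (h.1.trans hw.symm)) h.2
  · rintro ⟨⟩
    rfl

lemma fiber_interior (hp : AffineIndependent ℝ p) {n : ℕ} (w : List.Vector (Fin 3) n) (j : Fin 3)
    (hw : w.toList ≠ List.replicate w.toList.length j) :
    ∃ (w' : List.Vector (Fin 3) n) (k : Fin 3), w' ≠ w ∧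
      Finset.univ.filter (fun a => addressPoint p n a = Fw p w.toList (p j)) =
        {(w, j), (w', k)} := by
  obtain ⟨w', k, hl, hne, heq, huniq⟩ := exists_second_address hp hw
  refine ⟨⟨w', hl.trans w.2⟩, k, fun h => hne (congrArg List.Vector.toList h), ?_⟩
  ext ⟨u, l⟩
  simp only [Finset.mem_filter, Finset.mem_univ, true_and, Finset.mem_insert,
    Finset.mem_singleton]
  constructor
  · intro h
    refine (huniq u.toList l (u.2.trans w.2.symm) h).imp ?_ ?_
    · rintro ⟨h1, rfl⟩
      exact Prod.ext (List.Vector.eq _ _ h1) rfl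
    · rintro ⟨h1, rfl⟩
      exact Prod.ext (List.Vector.eq _ _ h1) rfl
  · rintro (h | h)
    · cases h
      rfl
    · cases h
      exact heq

lemma card_fiber (hp : AffineIndependent ℝ p) {n : ℕ} {x : Pt} (hx : x ∈ vertexFinset p n) :
    (Finset.univ.filter (fun a => addressPoint p n a = x)).card +
      (if x ∈ Set.range p then 1 else 0) = 2 := by
  obtain ⟨⟨w, j⟩, -, rfl⟩ := Finset.mem_image.1 hx
  change (Finset.univ.filter (fun a => addressPoint p n a = Fw p w.toList (p j))).card +
    (if Fw p w.toList (p j) ∈ Set.range p then 1 else 0) = 2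
  by_cases hc : w.toList = List.replicate w.toList.length j
  · rw [fiber_corner hp w j hc, if_pos ((Fw_mem_range_iff hp _ j).2 hc), Finset.card_singleton]
  · obtain ⟨w', k, hne, hf⟩ := fiber_interior hp w j hc
    rw [hf, if_neg (fun h => hc ((Fw_mem_range_iff hp _ j).1 h)),
      Finset.card_pair fun h => hne (Prod.ext_iff.1 h).1.symm]

lemma card_vertexFinset (hp : AffineIndependent ℝ p) (n : ℕ) :
    2 * (vertexFinset p n).card = 3 * 3 ^ n + 3 := by
  have hsum := Finset.sum_congr rfl fun x hx => card_fiber hp (n := n) (x := x) hx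
  have hcorners : (vertexFinset p n).filter (· ∈ Set.range p) = Finset.univ.image p := by
    ext x
    simp only [Finset.mem_filter, Finset.mem_image, Finset.mem_univ, true_and, Set.mem_range,
      and_iff_right_iff_imp]
    rintro ⟨j, rfl⟩
    exact mem_vertexFinset.2 ⟨List.replicate n j, by simp, j, (Fw_replicate n j).symm⟩
  have haddr := Finset.card_eq_sum_card_image (addressPoint p n) Finset.univ
  rw [← vertexFinset, Finset.card_univ, Fintype.card_prod, card_vector, Fintype.card_fin] at haddr
  rw [Finset.sum_add_distrib, ← haddr, ← Finset.card_filter, hcorners,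
    Finset.card_image_of_injective _ hp.injective, Finset.card_univ, Fintype.card_fin,
    Finset.sum_const, smul_eq_mul] at hsum
  linarith

/-- Extension by zero of functions on the vertices of `G_n`. -/
def extendVertices (p : Fin 3 → Pt) (n : ℕ) : (vertexFinset p n → ℝ) →ₗ[ℝ] (Pt → ℝ) :=
  Function.ExtendByZero.linearMap ℝ Subtype.val

lemma extendVertices_of_mem {n : ℕ} (f : vertexFinset p n → ℝ) {x : Pt}
    (hx : x ∈ vertexFinset p n) : extendVertices p n f x = f ⟨x, hx⟩ :=
  Subtype.val_injective.extend_apply f 0 ⟨x, hx⟩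

lemma extendVertices_of_notMem {n : ℕ} (f : vertexFinset p n → ℝ) {x : Pt}
    (hx : x ∉ vertexFinset p n) : extendVertices p n f x = 0 := by
  refine Function.extend_apply' f (0 : Pt → ℝ) x ?_
  rintro ⟨y, rfl⟩
  exact hx y.2

lemma extendVertices_injective (n : ℕ) : Function.Injective (extendVertices p n) := by
  intro f g h
  ext ⟨x, hx⟩
  rw [← extendVertices_of_mem f hx, h, extendVertices_of_mem g hx]

/-- The linear map sending a function on the vertices to its sums over the cells. -/
def cellSumMap (p : Fin 3 → Pt) (n : ℕ) :
    (vertexFinset p n → ℝ) →ₗ[ℝ] (List.Vector (Fin 3) n → ℝ) where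
  toFun f w := cellSum p (extendVertices p n f) w.toList
  map_add' f g := by
    ext w
    simp [cellSum, Finset.sum_add_distrib]
  map_smul' c f := by
    ext w
    simp [cellSum, Finset.mul_sum]

/-- The functions supported on the vertices of `G_n` all of whose cell sums vanish. -/
def cellSumKernel (p : Fin 3 → Pt) (n : ℕ) : Submodule ℝ (Pt → ℝ) :=
  (LinearMap.ker (cellSumMap p n)).map (extendVertices p n)

lemma mem_cellSumKernel {n : ℕ} {f : Pt → ℝ} :
    f ∈ cellSumKernel p n ↔ (∀ x ∉ VG p n, f x = 0) ∧
      ∀ w : List (Fin 3), w.length = n → cellSum p f w = 0 := by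
  constructor
  · rintro ⟨g, hg, rfl⟩
    refine ⟨fun x hx => extendVertices_of_notMem g fun h => hx (mem_vertexFinset.1 h), ?_⟩
    intro w hw
    exact congrFun (LinearMap.mem_ker.1 hg) ⟨w, hw⟩
  · rintro ⟨h0, hs⟩
    have hext : extendVertices p n (fun x => f x) = f := by
      ext x
      by_cases hx : x ∈ vertexFinset p n
      · exact extendVertices_of_mem _ hx
      · rw [extendVertices_of_notMem _ hx, h0 x fun h => hx (mem_vertexFinset.2 h)]
    refine ⟨fun x => f x, ?_, hext⟩
    refine LinearMap.mem_ker.2 (funext fun w => ?_)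
    change cellSum p (extendVertices p n fun x => f x) w.toList = 0
    rw [hext]
    exact hs _ w.2

lemma sum_mul_cellSumMap_single {n : ℕ} {x : Pt} (hx : x ∈ vertexFinset p n)
    (y : List.Vector (Fin 3) n → ℝ) :
    ∑ w, cellSumMap p n (Pi.single ⟨x, hx⟩ 1) w * y w =
      ∑ a with addressPoint p n a = x, y a.1 := by
  have hsingle : ∀ z, extendVertices p n (Pi.single ⟨x, hx⟩ 1) z =
      if z = x then (1 : ℝ) else 0 := by
    intro z
    by_cases hz : z ∈ vertexFinset p n
    · rw [extendVertices_of_mem _ hz, Pi.single_apply]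
      simp only [Subtype.mk.injEq]
    · rw [extendVertices_of_notMem _ hz, if_neg (fun h : z = x => hz (h ▸ hx))]
  rw [Finset.sum_filter, Fintype.sum_prod_type]
  refine Finset.sum_congr rfl fun w _ => ?_
  change (∑ k, extendVertices p n (Pi.single ⟨x, hx⟩ 1) (Fw p w.toList (p k))) * y w = _
  rw [Finset.sum_mul]
  refine Finset.sum_congr rfl fun k _ => ?_
  rw [hsingle, ite_mul, one_mul, zero_mul]
  rfl

lemma range_cellSumMap (hp : AffineIndependent ℝ p) (n : ℕ) :
    LinearMap.range (cellSumMap p n) = ⊤ := by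
  by_contra hne
  obtain ⟨φ, hφ, hle⟩ := Submodule.exists_le_ker_of_lt_top _ (lt_top_iff_ne_top.2 hne)
  set y : List.Vector (Fin 3) n → ℝ := fun w => φ fun u => if w = u then 1 else 0
  have hφy : ∀ g, φ g = ∑ w, g w * y w := fun g => φ.pi_apply_eq_sum_univ g
  have hfib : ∀ (w : List.Vector (Fin 3) n) (j : Fin 3),
      ∑ a with addressPoint p n a = Fw p w.toList (p j), y a.1 = 0 := by
    intro w j
    rw [← sum_mul_cellSumMap_single (mem_vertexFinset.2 ⟨w.toList, w.2, j, rfl⟩), ← hφy]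
    exact hle ⟨_, rfl⟩
  let Y : List (Fin 3) → ℝ := fun l => if h : l.length = n then y ⟨l, h⟩ else 0
  have hY : ∀ w : List.Vector (Fin 3) n, Y w.toList = y w := fun w => dif_pos w.2
  have hzero : ∀ w, y w = 0 := by
    intro w
    rw [← hY]
    refine eq_zero_of_alternating (p := p) n Y ?_ (v := List.replicate n 0) (by simp) ?_ w.2
    · rintro u u' hu hu' hne ⟨j, k, e⟩
      have hmem : ((⟨u', hu'⟩, k) : List.Vector (Fin 3) n × Fin 3) ∈
          Finset.univ.filter (fun a => addressPoint p n a = Fw p u (p j)) := by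
        exact Finset.mem_filter.2 ⟨Finset.mem_univ _, e.symm⟩
      have hne' : (⟨u, hu⟩ : List.Vector (Fin 3) n) ≠ ⟨u', hu'⟩ :=
        fun h => hne (congrArg List.Vector.toList h)
      have hs := hfib ⟨u, hu⟩ j
      by_cases hc : u = List.replicate u.length j
      · rw [show u = List.Vector.toList (n := n) ⟨u, hu⟩ from rfl,
          fiber_corner hp ⟨u, hu⟩ j hc, Finset.mem_singleton] at hmem
        exact absurd (Prod.ext_iff.1 hmem).1.symm hne'
      · obtain ⟨w', l, hw', hf⟩ := fiber_interior hp ⟨u, hu⟩ j hc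
        rw [hf, Finset.sum_pair fun h => hw' (Prod.ext_iff.1 h).1.symm, ← hY, ← hY] at hs
        rw [show u = List.Vector.toList (n := n) ⟨u, hu⟩ from rfl, hf, Finset.mem_insert,
          Finset.mem_singleton] at hmem
        rcases hmem with h | h
        · exact absurd (Prod.ext_iff.1 h).1.symm hne'
        · rw [← (Prod.ext_iff.1 h).1] at hs
          exact hs
    · have hs := hfib (List.Vector.replicate n 0) 0
      rw [fiber_corner hp _ _ (by simp [List.Vector.replicate]), Finset.sum_singleton, ← hY] at hs
      exact hs
  refine hφ (LinearMap.ext fun g => ?_)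
  rw [hφy]
  simp [hzero]

lemma finrank_cellSumKernel (hp : AffineIndependent ℝ p) (n : ℕ) :
    Module.finrank ℝ (cellSumKernel p n) = (3 ^ n + 3) / 2 := by
  have h1 := LinearMap.finrank_range_add_finrank_ker (cellSumMap p n)
  have h2 := LinearEquiv.finrank_eq (Submodule.equivMapOfInjective (extendVertices p n)
    (extendVertices_injective n) (LinearMap.ker (cellSumMap p n)))
  rw [range_cellSumMap hp, finrank_top, Module.finrank_fintype_fun_eq_card,
    Module.finrank_fintype_fun_eq_card, card_vector, Fintype.card_fin, Fintype.card_coe] at h1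
  have h3 := card_vertexFinset hp n
  rw [cellSumKernel, ← h2]
  omega

end

/-- `-3/2` is an eigenvalue of `Δ^G_n`; its eigenspace consists exactly of the
functions `f` with `Σ_{j=1}^3 f(F_w(p_j)) = 0` for every word `w` of length `n`,
and has dimension `(3^n+3)/2`. -/
theorem G_eigenvalue_neg_three_halves (p : Fin 3 → Pt)
    (hp : AffineIndependent ℝ p) (n : ℕ) :
    (∃ f : Pt → ℝ, (∀ x ∉ VG p n, f x = 0) ∧ (∃ x ∈ VG p n, f x ≠ 0) ∧
      ∀ x ∈ VG p n, lapG p n f x = (-3/2 : ℝ) * f x) ∧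
    ({f : Pt → ℝ | (∀ x ∉ VG p n, f x = 0) ∧
        ∀ x ∈ VG p n, lapG p n f x = (-3/2 : ℝ) * f x}
      = {f : Pt → ℝ | (∀ x ∉ VG p n, f x = 0) ∧
        ∀ w : List (Fin 3), w.length = n → ∑ j : Fin 3, f (Fw p w (p j)) = 0}) ∧
    ∃ b : Fin ((3 ^ n + 3) / 2) → (Pt → ℝ), LinearIndependent ℝ b ∧
      ∀ f : Pt → ℝ,
        f ∈ {f : Pt → ℝ | (∀ x ∉ VG p n, f x = 0) ∧
              ∀ x ∈ VG p n, lapG p n f x = (-3/2 : ℝ) * f x} ↔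
        f ∈ Submodule.span ℝ (Set.range b) := by
  have hmem : ∀ f : Pt → ℝ, ((∀ x ∉ VG p n, f x = 0) ∧
      ∀ x ∈ VG p n, lapG p n f x = (-3/2 : ℝ) * f x) ↔ f ∈ cellSumKernel p n := fun f => by
    rw [mem_cellSumKernel, eigen_iff_cellSum hp]
  have : Module.Finite ℝ (cellSumKernel p n) := by
    unfold cellSumKernel
    infer_instance
  let B := Module.finBasisOfFinrankEq ℝ (cellSumKernel p n) (finrank_cellSumKernel hp n)
  refine ⟨?_, ?_, fun i => B i, ?_, ?_⟩
  · let i : Fin ((3 ^ n + 3) / 2) := ⟨0, Nat.div_pos (Nat.le_add_left_of_le (by norm_num)) two_pos⟩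
    have hne : (B i : Pt → ℝ) ≠ 0 := fun h => B.ne_zero i (Subtype.ext h)
    obtain ⟨h0, hev⟩ := (hmem _).2 (B i).2
    obtain ⟨x, hx⟩ := Function.ne_iff.1 hne
    exact ⟨B i, h0, ⟨x, not_imp_comm.1 (h0 x) hx, hx⟩, hev⟩
  · ext f
    exact and_congr_right fun _ => eigen_iff_cellSum hp n f
  · exact B.linearIndependent.map' (cellSumKernel p n).subtype (Submodule.ker_subtype _)
  · intro f
    have hspan : Submodule.span ℝ (Set.range fun i => (B i : Pt → ℝ)) = cellSumKernel p n := by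
      rw [show (fun i => (B i : Pt → ℝ)) = (cellSumKernel p n).subtype ∘ B from rfl,
        Set.range_comp, Submodule.span_image, B.span_eq, Submodule.map_top,
        Submodule.range_subtype]
    rw [hspan]
    exact hmem f
end
end
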